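/- There exist a computable map f : [0,1] → [0,1] and a closed f-invariant set A ⊆ [0,1] such that: (1) the outer collection {(a,b) ∈ ℚ × ℚ : a < b, [a,b] ∩ A = ∅} is Σ₁ (so A is Π₁) and the complement of Halt many-one reduces to the inner collection {(a,b) ∈ ℚ × ℚ : a < b, (a,b) ∩ A ≠ ∅}; (2) f restricted to A is transitive (some point of A has forward orbit dense in A); (3) A is both a metric attractor and a statistical attractor of f with respect to Lebesgue measure on [0,1]; and (4) the associated physical measure, i.e. the f-invariant Borel probability measure μ with topological support A such that the empirical measures ν_n(x) converge weak-* to μ for Lebesgue-a.e. x, is not a computable measure. -/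

import Mathlib

open Filter Topology MeasureTheory Set
open scoped ENNReal NNReal

/-- Cylinder of a finite word in Cantor space: the set of sequences beginning with `w`. -/
def cyl {𝒜 : Type*} (w : List 𝒜) : Set (ℕ → 𝒜) :=
  {x | ∀ i : Fin w.length, x i = w.get i}

/-- The shift map on Cantor space. -/
def shiftMap {𝒜 : Type*} (x : ℕ → 𝒜) : ℕ → 𝒜 := fun i => x (i + 1)

/-- ω-limit set of `x` under iteration of `T`: the set of accumulation points of the orbit. -/
def omegaSet {X : Type*} [TopologicalSpace X] (T : X → X) (x : X) : Set X :=
  {y | MapClusterPt y Filter.atTop fun n => T^[n] x}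

/-- Realm of attraction `ρ(A) = {x : ω(x) ⊆ A}`. -/
def realm {X : Type*} [TopologicalSpace X] (T : X → X) (A : Set X) : Set X :=
  {x | omegaSet T x ⊆ A}

/-- `A` is a topological attractor of `T`: a closed invariant set whose realm of attraction is
residual, and such that no strictly smaller closed subset has nonmeager realm of attraction. -/
def IsTopAttractor {X : Type*} [TopologicalSpace X] (T : X → X) (A : Set X) : Prop :=
  IsClosed A ∧ Set.MapsTo T A A ∧ realm T A ∈ residual X ∧
    ∀ A' : Set X, IsClosed A' → A' ⊂ A → IsMeagre (realm T A')

/-- `A` is a metric attractor of `T` w.r.t. `lam`: a closed invariant set whose realm of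
attraction has full measure, and no strictly smaller closed subset has realm of positive
measure. -/
def IsMetricAttractor {X : Type*} [TopologicalSpace X] [MeasurableSpace X]
    (T : X → X) (lam : Measure X) (A : Set X) : Prop :=
  IsClosed A ∧ Set.MapsTo T A A ∧ lam (realm T A) = 1 ∧
    ∀ A' : Set X, IsClosed A' → A' ⊂ A → lam (realm T A') = 0

/-- Empirical (Birkhoff) measures `ν_n(x) = (1/n) ∑_{i<n} δ_{T^i x}`. -/
noncomputable def empMeasure {X : Type*} [MeasurableSpace X] (T : X → X) (x : X) (n : ℕ) :
    Measure X :=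
  (n : ℝ≥0∞)⁻¹ • ∑ i ∈ Finset.range n, Measure.dirac (T^[i] x)

/-- Weak-* convergence of a sequence of measures: integrals of continuous functions converge. -/
def WeakTendsto {X : Type*} [TopologicalSpace X] [MeasurableSpace X]
    (μs : ℕ → Measure X) (μ : Measure X) : Prop :=
  ∀ φ : C(X, ℝ), Filter.Tendsto (fun n => ∫ x, φ x ∂(μs n)) Filter.atTop (nhds (∫ x, φ x ∂μ))

/-- Topological support of a measure: points all of whose open neighbourhoods have positive
measure. -/
def measSupport {X : Type*} [TopologicalSpace X] [MeasurableSpace X]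
    (μ : Measure X) : Set X :=
  {x | ∀ U : Set X, IsOpen U → x ∈ U → 0 < μ U}

/-- `A` is a statistical (physical) attractor of `T` w.r.t. `lam`: there is a `T`-invariant
probability measure `μ` with support `A` such that for `lam`-a.e. `x` the empirical measures
converge weak-* to `μ`. -/
def IsStatAttractor {X : Type*} [TopologicalSpace X] [MeasurableSpace X]
    (T : X → X) (lam : Measure X) (A : Set X) : Prop :=
  IsClosed A ∧ ∃ μ : Measure X, IsProbabilityMeasure μ ∧
    Measure.map T μ = μ ∧ measSupport μ = A ∧
    ∀ᵐ x ∂lam, WeakTendsto (empMeasure T x) μ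

/-- `A` is strongly attracting: there is an open `U ⊇ A` with `T (closure U) ⊆ U` and
`A = ⋂ₙ Tⁿ(U)`. -/
def StronglyAttracting {X : Type*} [TopologicalSpace X] (T : X → X) (A : Set X) : Prop :=
  ∃ U : Set X, IsOpen U ∧ A ⊆ U ∧ T '' (closure U) ⊆ U ∧ A = ⋂ n : ℕ, T^[n] '' U

/-- `S` is Σ₁ (recursively enumerable). -/
def SigmaOne {I : Type*} [Primcodable I] (S : Set I) : Prop :=
  ∃ f : I × ℕ → Bool, Computable f ∧ ∀ i, i ∈ S ↔ ∃ a, f (i, a) = true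

/-- `S` is Π₁ (co-r.e.). -/
def PiOne {I : Type*} [Primcodable I] (S : Set I) : Prop := SigmaOne Sᶜ

/-- `S` is Σ₂. -/
def SigmaTwo {I : Type*} [Primcodable I] (S : Set I) : Prop :=
  ∃ f : I × ℕ × ℕ → Bool, Computable f ∧ ∀ i, i ∈ S ↔ ∃ a, ∀ b, f (i, a, b) = true

/-- `S` is Π₂. -/
def PiTwo {I : Type*} [Primcodable I] (S : Set I) : Prop :=
  ∃ f : I × ℕ × ℕ → Bool, Computable f ∧ ∀ i, i ∈ S ↔ ∀ a, ∃ b, f (i, a, b) = true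

/-- A map of Cantor space is computable if `(T x) n` is computed by a computable function from
`n` and the finite prefix `[x 0, …, x (α n)]` of `x`, for a computable modulus `α`. -/
def CantorComputable {𝒜 : Type} [Primcodable 𝒜] (T : (ℕ → 𝒜) → (ℕ → 𝒜)) : Prop :=
  ∃ (α : ℕ → ℕ) (β : ℕ → List 𝒜 → 𝒜), Computable α ∧ Computable₂ β ∧
    ∀ (x : ℕ → 𝒜) (n : ℕ), T x n = β n (List.ofFn fun i : Fin (α n + 1) => x i)

/-- A Borel probability measure on Cantor space is computable if the measures of finite unions
of cylinders are uniformly lower-computable: `lam(⋃_{w ∈ W} [w]) = sup_k q (W, k)` for a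
computable `q`. -/
def ComputableCantorMeasure {𝒜 : Type} [Primcodable 𝒜] [MeasurableSpace 𝒜]
    (lam : Measure (ℕ → 𝒜)) : Prop :=
  ∃ q : List (List 𝒜) × ℕ → ℚ, Computable q ∧
    ∀ W : List (List 𝒜), (lam (⋃ w ∈ W, cyl w)).toReal = ⨆ k, (q (W, k) : ℝ)

/-- Indices of machines halting on input 0. -/
def HaltSet : Set ℕ := {e | ((Denumerable.ofNat Nat.Partrec.Code e).eval 0).Dom}

/-- Indices of total machines. -/
def TotSet : Set ℕ := {e | ∀ n, ((Denumerable.ofNat Nat.Partrec.Code e).eval n).Dom}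

/-- Indices of machines with finite domain. -/
def FinSet : Set ℕ := {e | {n | ((Denumerable.ofNat Nat.Partrec.Code e).eval n).Dom}.Finite}

/-- A map `f : [0,1] → [0,1]` is computable: there are computable `m : ℕ → ℕ` and
`ψ : ℚ × ℕ → ℚ` such that whenever `x ∈ [0,1]` and `|x - q| ≤ 2^{-m n}`,
`|f x - ψ (q, n)| ≤ 2^{-n}`. -/
def ComputableRealMap (f : ℝ → ℝ) : Prop :=
  ∃ (m : ℕ → ℕ) (ψ : ℚ × ℕ → ℚ), Computable m ∧ Computable ψ ∧
    ∀ x ∈ Set.Icc (0:ℝ) 1, ∀ (q : ℚ) (n : ℕ),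
      |x - (q : ℝ)| ≤ 1 / 2 ^ (m n) → |f x - (ψ (q, n) : ℝ)| ≤ 1 / 2 ^ n

/-- A map `φ` from Cantor space to ℝ is computable: a rational `2^{-n}`-approximation of `φ x`
is computed from `n` and the finite prefix `[x 0, …, x (k n)]` of `x`. -/
def ComputableCantorRealMap (φ : (ℕ → Bool) → ℝ) : Prop :=
  ∃ (k : ℕ → ℕ) (Φ : ℕ × List Bool → ℚ), Computable k ∧ Computable Φ ∧
    ∀ (x : ℕ → Bool) (n : ℕ),
      |φ x - (Φ (n, List.ofFn fun i : Fin (k n + 1) => x i) : ℝ)| ≤ 1 / 2 ^ n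

/-- A closed `K ⊆ [0,1]` is a computable closed set: both the rational open intervals meeting
`K` and the rational closed intervals missing `K` are Σ₁. -/
def ComputableClosedReal (K : Set ℝ) : Prop :=
  SigmaOne {p : ℚ × ℚ | p.1 < p.2 ∧ (Set.Ioo (p.1 : ℝ) (p.2 : ℝ) ∩ K).Nonempty} ∧
  SigmaOne {p : ℚ × ℚ | p.1 < p.2 ∧ Set.Icc (p.1 : ℝ) (p.2 : ℝ) ∩ K = ∅}

/-- A Borel probability measure on `[0,1] ⊆ ℝ` is computable if the measures of finite unions
of rational open intervals are uniformly lower-computable. -/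
def ComputableIntervalMeasure (μ : MeasureTheory.Measure ℝ) : Prop :=
  ∃ q : List (ℚ × ℚ) × ℕ → ℚ, Computable q ∧
    ∀ W : List (ℚ × ℚ),
      (μ (⋃ p ∈ W, Set.Ioo (p.1 : ℝ) (p.2 : ℝ))).toReal = ⨆ k, (q (W, k) : ℝ)

/-! ### Computability of rational arithmetic -/

theorem primrec_nat_pow : Primrec₂ ((· ^ ·) : ℕ → ℕ → ℕ) :=
  Primrec₂.unpaired'.1 Nat.Primrec.pow

theorem primrec_nat_dvd : PrimrecRel ((· ∣ ·) : ℕ → ℕ → Prop) := by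
  have h : PrimrecRel fun a b : ℕ => b % a = 0 :=
    Primrec.eq.comp₂ (Primrec.nat_mod.comp₂ Primrec₂.right Primrec₂.left) (Primrec₂.const 0)
  exact h.of_eq fun a b => (Nat.dvd_iff_mod_eq_zero).symm

theorem primrec_nat_gcd : Primrec₂ Nat.gcd := by
  have hR : PrimrecRel fun (p : ℕ × ℕ) (k : ℕ) => k ∣ p.1 ∧ k ∣ p.2 := by
    refine PrimrecPred.and ?_ ?_
    · exact primrec_nat_dvd.comp Primrec.snd (Primrec.fst.comp Primrec.fst)
    · exact primrec_nat_dvd.comp Primrec.snd (Primrec.snd.comp Primrec.fst)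
  have h := Primrec.nat_findGreatest
    (Primrec.nat_add.comp (Primrec.fst (α := ℕ) (β := ℕ)) Primrec.snd) hR
  refine Primrec.of_eq h fun p => ?_
  obtain ⟨a, b⟩ := p
  rw [Nat.findGreatest_eq_iff]
  refine ⟨?_, fun _ => ⟨Nat.gcd_dvd_left _ _, Nat.gcd_dvd_right _ _⟩, ?_⟩
  · rcases Nat.eq_zero_or_pos a with rfl | ha
    · simp
    · exact (Nat.gcd_le_left b ha).trans (Nat.le_add_right _ _)
  · intro n hn hle ⟨h1, h2⟩
    have hd := Nat.dvd_gcd h1 h2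
    rcases Nat.eq_zero_or_pos (a.gcd b) with h0 | h0
    · simp only at hle
      rw [Nat.gcd_eq_zero_iff] at h0
      omega
    · exact absurd (Nat.le_of_dvd h0 hd) (not_le.2 hn)

/-- The code of a rational as the pair of the code of its numerator and its denominator. -/
def ratPairCode (q : ℚ) : ℕ := @Encodable.encode ℚ Rat.instEncodable q

theorem ratPairCode_eq (q : ℚ) :
    ratPairCode q = Nat.pair (Encodable.encode q.num) q.den := rfl

/-- The pairs that are codes of rationals. -/
def IsRatPairCode (k : ℕ) : Prop :=
  0 < k.unpair.2 ∧ Nat.gcd ((k.unpair.1 + 1) / 2) k.unpair.2 = 1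

instance : DecidablePred IsRatPairCode := fun k => by unfold IsRatPairCode; infer_instance

theorem encode_int_natAbs (z : ℤ) : (Encodable.encode z + 1) / 2 = z.natAbs := by
  cases z with
  | ofNat n =>
    have : Encodable.encode (Int.ofNat n) = 2 * n := rfl
    rw [this, Int.natAbs]; omega
  | negSucc n =>
    have : Encodable.encode (Int.negSucc n) = 2 * n + 1 := rfl
    rw [this, Int.natAbs]; omega

theorem isRatPairCode_iff (k : ℕ) : IsRatPairCode k ↔ k ∈ Set.range ratPairCode := by
  constructor
  · rintro ⟨h1, h2⟩
    set z : ℤ := Denumerable.ofNat ℤ k.unpair.1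
    have hz : Encodable.encode z = k.unpair.1 := Denumerable.encode_ofNat _
    rw [← hz, encode_int_natAbs] at h2
    refine ⟨⟨z, k.unpair.2, h1.ne', h2⟩, ?_⟩
    rw [ratPairCode_eq]
    simp only [hz, Nat.pair_unpair]
  · rintro ⟨q, rfl⟩
    rw [ratPairCode_eq, IsRatPairCode]
    simp only [Nat.unpair_pair, encode_int_natAbs]
    exact ⟨q.den_pos, q.reduced⟩

theorem primrec_isRatPairCode : PrimrecPred IsRatPairCode := by
  refine PrimrecPred.and ?_ ?_
  · exact Primrec.nat_lt.comp (Primrec.const 0) (Primrec.snd.comp Primrec.unpair)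
  · refine Primrec.eq.comp (primrec_nat_gcd.comp ?_ (Primrec.snd.comp Primrec.unpair))
      (Primrec.const 1)
    exact Primrec.nat_div.comp (Primrec.succ.comp (Primrec.fst.comp Primrec.unpair))
      (Primrec.const 2)

theorem primrec_count {p : ℕ → Prop} [DecidablePred p] (hp : PrimrecPred p) :
    Primrec (Nat.count p) := by
  have h : Primrec fun n => ((List.range n).filter fun x => p x).length :=
    Primrec.list_length.comp ((Primrec.listFilter hp).comp Primrec.list_range)
  refine h.of_eq fun n => ?_
  rw [Nat.count, List.countP_eq_length_filter]

theorem encode_rat (q : ℚ) : @Encodable.encode ℚ Primcodable.toEncodable q =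
    Nat.count IsRatPairCode (ratPairCode q) := by
  classical
  let _ : DecidablePred (· ∈ Set.range (@Encodable.encode ℚ Rat.instEncodable)) :=
    @Encodable.decidableRangeEncode ℚ Rat.instEncodable
  have h : @Encodable.encode ℚ Primcodable.toEncodable q = (List.range (ratPairCode q)).countP
    (· ∈ Set.range (@Encodable.encode ℚ Rat.instEncodable)) := rfl
  rw [h, Nat.count]
  apply List.countP_congr
  intro x _
  simp only [decide_eq_true_eq]
  exact (isRatPairCode_iff x).symm

theorem computable_ratPairCode : Computable ratPairCode := by
  have hR : PrimrecPred fun p : ℚ × ℕ =>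
      IsRatPairCode p.2 ∧ Nat.count IsRatPairCode p.2 =
        @Encodable.encode ℚ Primcodable.toEncodable p.1 :=
    (primrec_isRatPairCode.comp Primrec.snd).and
      (Primrec.eq.comp ((primrec_count primrec_isRatPairCode).comp Primrec.snd)
        (Primrec.encode.comp Primrec.fst))
  have h : Partrec fun q : ℚ => Nat.rfind fun k => Part.some
      (decide (IsRatPairCode k ∧ Nat.count IsRatPairCode k =
        @Encodable.encode ℚ Primcodable.toEncodable q)) := by
    apply Partrec.rfind
    exact hR.decide.to_comp.partrec
  refine h.of_eq fun q => ?_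
  refine Part.eq_some_iff.2 (Nat.mem_rfind.2 ?_)
  have hself := (isRatPairCode_iff _).2 ⟨q, rfl⟩
  constructor
  · simp [encode_rat, hself]
  · intro m hm
    simp only [Part.mem_some_iff]
    symm
    rw [decide_eq_false_iff_not]
    rintro ⟨h1, h2⟩
    rw [encode_rat] at h2
    exact hm.ne (Nat.count_injective h1 hself h2)

theorem computable_rat_den : Computable fun q : ℚ => q.den := by
  refine (((Primrec.snd.comp Primrec.unpair).to_comp).comp computable_ratPairCode).of_eq
    fun q => ?_
  simp [ratPairCode_eq]

theorem computable_rat_num : Computable fun q : ℚ => q.num.toNat := by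
  have h : Primrec fun k : ℕ => if k.unpair.1 % 2 = 0 then k.unpair.1 / 2 else 0 :=
    Primrec.ite (Primrec.eq.comp (Primrec.nat_mod.comp (Primrec.fst.comp Primrec.unpair)
      (Primrec.const 2)) (Primrec.const 0))
      (Primrec.nat_div.comp (Primrec.fst.comp Primrec.unpair) (Primrec.const 2))
      (Primrec.const 0)
  refine (h.to_comp.comp computable_ratPairCode).of_eq fun q => ?_
  rw [ratPairCode_eq]
  simp only [Nat.unpair_pair]
  cases q.num with
  | ofNat n =>
    have : Encodable.encode (Int.ofNat n) = 2 * n := rfl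
    rw [this, if_pos (by omega)]; simp
  | negSucc n =>
    have : Encodable.encode (Int.negSucc n) = 2 * n + 1 := rfl
    rw [this, if_neg (by omega)]; simp

theorem primrec_rat_div : Primrec fun p : ℕ × ℕ => ((p.1 : ℚ) / ((p.2 + 1 : ℕ) : ℚ)) := by
  have hg : Primrec fun p : ℕ × ℕ => Nat.gcd p.1 (p.2 + 1) :=
    primrec_nat_gcd.comp Primrec.fst (Primrec.succ.comp Primrec.snd)
  have h : Primrec fun p : ℕ × ℕ => Nat.count IsRatPairCode
      (Nat.pair (2 * (p.1 / Nat.gcd p.1 (p.2 + 1))) ((p.2 + 1) / Nat.gcd p.1 (p.2 + 1))) :=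
    (primrec_count primrec_isRatPairCode).comp (Primrec₂.natPair.comp
      (Primrec.nat_mul.comp (Primrec.const 2) (Primrec.nat_div.comp Primrec.fst hg))
      (Primrec.nat_div.comp (Primrec.succ.comp Primrec.snd) hg))
  refine Primrec.encode_iff.1 (h.of_eq fun p => ?_)
  obtain ⟨a, b⟩ := p
  refine Eq.trans ?_ (encode_rat _).symm
  rw [ratPairCode_eq]
  have hnum : ((a : ℚ) / ((b + 1 : ℕ) : ℚ)).num = Int.ofNat (a / Nat.gcd a (b + 1)) := by
    rw [Rat.natCast_div_eq_divInt, Rat.num_divInt]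
    have h1 : Int.gcd ((b + 1 : ℕ) : ℤ) (a : ℤ) = Nat.gcd a (b + 1) := by
      rw [Int.gcd_natCast_natCast, Nat.gcd_comm]
    rw [h1, Int.sign_natCast_of_ne_zero (Nat.succ_ne_zero b), one_mul]
    simp
  have hden : ((a : ℚ) / ((b + 1 : ℕ) : ℚ)).den = (b + 1) / Nat.gcd a (b + 1) := by
    rw [Rat.natCast_div_eq_divInt, Rat.den_divInt]
    have h1 : Int.gcd ((b + 1 : ℕ) : ℤ) (a : ℤ) = Nat.gcd a (b + 1) := by
      rw [Int.gcd_natCast_natCast, Nat.gcd_comm]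
    rw [h1, if_neg (by exact_mod_cast Nat.succ_ne_zero b), Int.natAbs_natCast]
  have henc : ∀ n : ℕ, Encodable.encode (Int.ofNat n) = 2 * n := fun _ => rfl
  rw [hnum, hden, henc]

/-! ### The symbolic sequences -/

/-- The `i`-th ternary digit of `j`. -/
def ternaryDigit (j i : ℕ) : ℕ := j / 3 ^ i % 3

/-- The word `2 1ᵉ 2` occurs in `x` at position `i`. -/
def MarkerAt (x : ℕ → ℕ) (i e : ℕ) : Prop :=
  x i = 2 ∧ (∀ k < e, x (i + 1 + k) = 1) ∧ x (i + 1 + e) = 2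

/-- None of the words `2 1ᵉ 2` with `e ∈ S` occurs in `x`. -/
def Avoids (S : Set ℕ) (x : ℕ → ℕ) : Prop := ∀ i e, e ∈ S → ¬ MarkerAt x i e

/-- Indices of machines which halt on input 0 within the resource bound `N`. -/
def haltedBy (N : ℕ) : Set ℕ :=
  {e | (Nat.Partrec.Code.evaln N (Denumerable.ofNat Nat.Partrec.Code e) 0).isSome = true}

theorem haltedBy_mono {M N : ℕ} (h : M ≤ N) : haltedBy M ⊆ haltedBy N := by
  intro e he
  simp only [haltedBy, mem_ofPred_eq, Option.isSome_iff_exists] at he ⊢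
  obtain ⟨a, ha⟩ := he
  exact ⟨a, Nat.Partrec.Code.evaln_mono h ha⟩

theorem mem_HaltSet_iff {e : ℕ} : e ∈ HaltSet ↔ ∃ N, e ∈ haltedBy N := by
  simp only [HaltSet, haltedBy, mem_ofPred_eq, Option.isSome_iff_exists, Part.dom_iff_mem]
  constructor
  · rintro ⟨y, hy⟩
    obtain ⟨N, hN⟩ := Nat.Partrec.Code.evaln_complete.1 hy
    exact ⟨N, y, hN⟩
  · rintro ⟨N, y, hN⟩
    exact ⟨y, Nat.Partrec.Code.evaln_sound hN⟩

/-- The ternary digit sequence of `j` avoids the markers of machines which halt within `N`. -/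
def GoodAt (N j : ℕ) : Prop :=
  ∀ e < j + 1, ∀ i < j + 1, ¬ (e ∈ haltedBy N ∧ MarkerAt (ternaryDigit j) i e)

/-- The exponent of `2` in `m + 1`. -/
def ruler (m : ℕ) : ℕ := Nat.findGreatest (fun k => 2 ^ k ∣ m + 1) m

/-- The periodic sequence repeating the first `j + 1` ternary digits of `j`. -/
def perSeq (j n : ℕ) : ℕ := ternaryDigit j (n % (j + 1))

/-- The sequence following `perSeq (K m)` on the block `(m², (m+1)²)`, and vanishing on squares. -/
def blockSeq (K : ℕ → ℕ) (n : ℕ) : ℕ :=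
  if n.sqrt * n.sqrt = n then 0 else perSeq (K n.sqrt) n

open Classical in
/-- The block selector used by the computable sequence. -/
noncomputable def stageSelector (m : ℕ) : ℕ := if GoodAt m (ruler m) then ruler m else 0

/-- The integer with base seven digits `2 x₀, …, 2 x_{N-1}`. -/
def prefixVal (x : ℕ → ℕ) : ℕ → ℕ
  | 0 => 0
  | N + 1 => 7 * prefixVal x N + 2 * x N

theorem primrec_ternaryDigit : Primrec₂ ternaryDigit :=
  Primrec.nat_mod.comp (Primrec.nat_div.comp Primrec.fst
    (primrec_nat_pow.comp (Primrec.const 3) Primrec.snd)) (Primrec.const 3)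

theorem PrimrecPred.forall_lt_comp {α : Type*} [Primcodable α] {p : α × ℕ → Prop}
    (hp : PrimrecPred p) {f : α → ℕ} (hf : Primrec f) :
    PrimrecPred fun a => ∀ k < f a, p (a, k) := by
  have hR : PrimrecRel fun (k : ℕ) (a : α) => p (a, k) :=
    hp.comp (Primrec.pair Primrec.snd Primrec.fst)
  have h := hR.forall_mem_list
  exact (h.comp (Primrec.list_range.comp hf) Primrec.id).of_eq fun a => by simp

theorem primrec_goodAt : PrimrecRel GoodAt := by
  have hhalt : PrimrecPred fun q : (((ℕ × ℕ) × ℕ) × ℕ) => q.1.2 ∈ haltedBy q.1.1.1 := by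
    have h1 : Primrec fun q : (((ℕ × ℕ) × ℕ) × ℕ) =>
        (Nat.Partrec.Code.evaln q.1.1.1 (Denumerable.ofNat Nat.Partrec.Code q.1.2) 0).isSome :=
      Primrec.option_isSome.comp (Nat.Partrec.Code.primrec_evaln.comp
        (Primrec.pair (Primrec.pair (Primrec.fst.comp (Primrec.fst.comp Primrec.fst))
          ((Primrec.ofNat _).comp (Primrec.snd.comp Primrec.fst))) (Primrec.const 0)))
    exact Primrec.eq.comp h1 (Primrec.const true)
  have hmark : PrimrecPred fun q : (((ℕ × ℕ) × ℕ) × ℕ) =>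
      MarkerAt (ternaryDigit q.1.1.2) q.2 q.1.2 := by
    have hj : Primrec fun q : (((ℕ × ℕ) × ℕ) × ℕ) => q.1.1.2 :=
      Primrec.snd.comp (Primrec.fst.comp Primrec.fst)
    have he : Primrec fun q : (((ℕ × ℕ) × ℕ) × ℕ) => q.1.2 := Primrec.snd.comp Primrec.fst
    refine PrimrecPred.and ?_ (PrimrecPred.and ?_ ?_)
    · exact Primrec.eq.comp (primrec_ternaryDigit.comp hj Primrec.snd) (Primrec.const 2)
    · have h : PrimrecPred fun r : (((ℕ × ℕ) × ℕ) × ℕ) × ℕ =>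
          ternaryDigit r.1.1.1.2 (r.1.2 + 1 + r.2) = 1 :=
        Primrec.eq.comp (primrec_ternaryDigit.comp (hj.comp Primrec.fst)
          (Primrec.nat_add.comp (Primrec.succ.comp (Primrec.snd.comp Primrec.fst)) Primrec.snd))
          (Primrec.const 1)
      exact h.forall_lt_comp he
    · exact Primrec.eq.comp (primrec_ternaryDigit.comp hj
        (Primrec.nat_add.comp (Primrec.succ.comp Primrec.snd) he)) (Primrec.const 2)
  have h := PrimrecPred.forall_lt_comp ((hhalt.and hmark).not)
    (f := fun q : (ℕ × ℕ) × ℕ => q.1.2 + 1)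
    (Primrec.succ.comp (Primrec.snd.comp Primrec.fst))
  exact PrimrecPred.forall_lt_comp h (f := fun q : ℕ × ℕ => q.2 + 1)
    (Primrec.succ.comp Primrec.snd)

theorem primrec_ruler : Primrec ruler := by
  have hR : PrimrecRel fun (m k : ℕ) => 2 ^ k ∣ m + 1 :=
    primrec_nat_dvd.comp (primrec_nat_pow.comp (Primrec.const 2) Primrec.snd)
      (Primrec.succ.comp Primrec.fst)
  exact Primrec.nat_findGreatest Primrec.id hR

theorem primrec_stageSelector : Primrec stageSelector := by
  classical
  exact Primrec.ite (primrec_goodAt.comp Primrec.id primrec_ruler) primrec_ruler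
    (Primrec.const 0)

theorem primrec_perSeq : Primrec₂ perSeq :=
  primrec_ternaryDigit.comp Primrec.fst
    (Primrec.nat_mod.comp Primrec.snd (Primrec.succ.comp Primrec.fst))

theorem Primrec.blockSeq {K : ℕ → ℕ} (hK : Primrec K) : Primrec (blockSeq K) := by
  refine Primrec.ite (Primrec.eq.comp (Primrec.nat_mul.comp Primrec.nat_sqrt Primrec.nat_sqrt)
    Primrec.id) (Primrec.const 0) ?_
  exact primrec_perSeq.comp (hK.comp Primrec.nat_sqrt) Primrec.id

theorem Primrec₂.prefixVal {α : Type*} [Primcodable α] {x : α → ℕ → ℕ} (hx : Primrec₂ x) :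
    Primrec₂ fun a N => prefixVal (x a) N := by
  have h : Primrec₂ fun (a : α) (N : ℕ) =>
      (Nat.rec 0 (fun n r => 7 * r + 2 * x a n) N : ℕ) := by
    refine Primrec.nat_rec (f := fun _ => 0) (g := fun a (p : ℕ × ℕ) => 7 * p.2 + 2 * x a p.1)
      (Primrec.const 0) ?_
    refine Primrec.nat_add.comp (Primrec.nat_mul.comp (Primrec.const 7)
      (Primrec.snd.comp Primrec.snd)) (Primrec.nat_mul.comp (Primrec.const 2)
      (hx.comp Primrec.fst (Primrec.fst.comp Primrec.snd)))
  refine h.of_eq fun a N => ?_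
  induction N with
  | zero => rfl
  | succ N ih => simp only [_root_.prefixVal, ← ih]

theorem ternaryDigit_lt (j i : ℕ) : ternaryDigit j i < 3 := Nat.mod_lt _ (by norm_num)

theorem ternaryDigit_eq_zero {j i : ℕ} (h : j < 3 ^ i) : ternaryDigit j i = 0 := by
  simp [ternaryDigit, Nat.div_eq_of_lt h]

theorem ternaryDigit_eq_zero_of_le {j i : ℕ} (h : j ≤ i) : ternaryDigit j i = 0 :=
  ternaryDigit_eq_zero (h.trans_lt (Nat.lt_pow_self (by norm_num)))

theorem MarkerAt.ne_zero {x : ℕ → ℕ} {i e : ℕ} (h : MarkerAt x i e) {k : ℕ} (hk : k ≤ e + 1) :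
    x (i + k) ≠ 0 := by
  obtain ⟨h0, h1, h2⟩ := h
  rcases k with _ | k
  · simp [h0]
  · rcases Nat.lt_or_ge k e with hlt | hge
    · have := h1 k hlt
      rw [show i + (k + 1) = i + 1 + k by ring, this]; norm_num
    · have : k = e := by omega
      subst this
      rw [show i + (k + 1) = i + 1 + k by ring, h2]; norm_num

theorem MarkerAt.congr {x y : ℕ → ℕ} {i i' e : ℕ} (h : MarkerAt x i e)
    (hxy : ∀ k ≤ e + 1, y (i' + k) = x (i + k)) : MarkerAt y i' e := by
  obtain ⟨h0, h1, h2⟩ := h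
  refine ⟨by simpa [h0] using hxy 0 (by omega), fun k hk => ?_, ?_⟩
  · have := hxy (1 + k) (by omega)
    rw [← add_assoc, ← add_assoc] at this
    rw [this, h1 k hk]
  · have := hxy (1 + e) (by omega)
    rw [← add_assoc, ← add_assoc] at this
    rw [this, h2]

theorem Avoids.mono {S T : Set ℕ} (h : S ⊆ T) {x : ℕ → ℕ} (hx : Avoids T x) : Avoids S x :=
  fun i e he => hx i e (h he)

theorem Avoids.shift {S : Set ℕ} {x : ℕ → ℕ} (hx : Avoids S x) (n : ℕ) :
    Avoids S fun i => x (i + n) := fun i e he hm =>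
  hx (i + n) e he (hm.congr fun k _ => by rw [add_right_comm])

theorem goodAt_iff {N j : ℕ} : GoodAt N j ↔ Avoids (haltedBy N) (ternaryDigit j) := by
  constructor
  · intro h i e he hm
    have h1 : i + (e + 1) < j := by
      by_contra hc
      exact hm.ne_zero le_rfl (ternaryDigit_eq_zero_of_le (not_lt.1 hc))
    exact h e (by omega) i (by omega) ⟨he, hm⟩
  · rintro h e - i - ⟨he, hm⟩
    exact h i e he hm

theorem perSeq_lt (j n : ℕ) : perSeq j n < 3 := ternaryDigit_lt _ _

theorem perSeq_of_le {j n : ℕ} (h : n ≤ j) : perSeq j n = ternaryDigit j n := by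
  rw [perSeq, Nat.mod_eq_of_lt (by omega)]

theorem perSeq_add_period (j n : ℕ) : perSeq j (n + (j + 1)) = perSeq j n := by
  simp [perSeq]

theorem Avoids.perSeq {S : Set ℕ} {j : ℕ} (h : Avoids S (ternaryDigit j)) :
    Avoids S (perSeq j) := by
  intro i e he hm
  have hr := Nat.mod_lt i (Nat.succ_pos j)
  have hdm := Nat.mod_add_div i (j + 1)
  simp only [Nat.succ_eq_add_one] at hr
  set r := i % (j + 1) with hrdef
  have hle : r + (e + 1) ≤ j := by
    by_contra hc
    refine hm.ne_zero (k := j - r) (by omega) ?_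
    have : (i + (j - r)) % (j + 1) = j := by
      have : i + (j - r) = j + (j + 1) * (i / (j + 1)) := by omega
      rw [this, Nat.add_mul_mod_self_left, Nat.mod_eq_of_lt (by omega)]
    rw [_root_.perSeq, this, ternaryDigit_eq_zero_of_le le_rfl]
  refine h r e he (hm.congr fun k hk => ?_)
  have : (i + k) % (j + 1) = r + k := by
    have : i + k = r + k + (j + 1) * (i / (j + 1)) := by omega
    rw [this, Nat.add_mul_mod_self_left, Nat.mod_eq_of_lt (by omega)]
  rw [_root_.perSeq, this]

theorem blockSeq_lt (K : ℕ → ℕ) (n : ℕ) : blockSeq K n < 3 := by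
  unfold blockSeq
  split_ifs
  · norm_num
  · exact perSeq_lt _ _

theorem blockSeq_of_lt {K : ℕ → ℕ} {m s : ℕ} (hs : s < 2 * m) :
    blockSeq K (m * m + 1 + s) = perSeq (K m) (m * m + 1 + s) := by
  have h : Nat.sqrt (m * m + 1 + s) = m := by
    symm
    refine Nat.eq_sqrt.2 ⟨?_, ?_⟩
    · omega
    · nlinarith
  unfold blockSeq
  rw [h, if_neg (by omega)]

theorem Avoids.blockSeq {S : Set ℕ} {K : ℕ → ℕ} {n : ℕ}
    (h : ∀ m, Nat.sqrt n ≤ m → Avoids S (ternaryDigit (K m))) :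
    Avoids S fun i => blockSeq K (i + n) := by
  intro i e he hm
  have hns : ∀ k ≤ e + 1, Nat.sqrt (i + k + n) * Nat.sqrt (i + k + n) ≠ i + k + n :=
    fun k hk hsq => hm.ne_zero hk (by simp [_root_.blockSeq, hsq])
  have hs : ∀ k ≤ e + 1, Nat.sqrt (i + k + n) = Nat.sqrt (i + n) := by
    intro k
    induction k with
    | zero => simp
    | succ k ih =>
      intro hk
      have h1 := ih (by omega)
      have h2 := hns (k + 1) hk
      rw [← h1]
      have h3 : i + (k + 1) + n = (i + k + n) + 1 := by ring
      rw [h3] at h2 ⊢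
      have h4 := Nat.sqrt_le (i + k + n)
      have h5 := Nat.lt_succ_sqrt (i + k + n)
      simp only [Nat.succ_eq_add_one] at h5
      refine (Nat.eq_sqrt.2 ⟨by omega, ?_⟩).symm
      refine lt_of_le_of_ne (by omega) fun h6 => h2 ?_
      rw [h6, Nat.sqrt_eq]
  refine (h (Nat.sqrt (i + n)) (Nat.sqrt_le_sqrt (by omega))).perSeq (i + n) e he
    (hm.congr fun k hk => ?_)
  simp only [_root_.blockSeq]
  rw [if_neg (hns k hk), hs k hk]
  congr 1; omega

theorem exists_ternaryDigit_eq (x : ℕ → ℕ) (hx : ∀ i, x i < 3) (N : ℕ) :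
    ∃ j < 3 ^ N, ∀ i < N, ternaryDigit j i = x i := by
  induction N with
  | zero => exact ⟨0, by simp, by simp⟩
  | succ N ih =>
    obtain ⟨j, hj, h⟩ := ih
    refine ⟨j + 3 ^ N * x N, ?_, fun i hi => ?_⟩
    · have := hx N
      rw [pow_succ]
      nlinarith [Nat.mul_le_mul_left (3 ^ N) (show x N ≤ 2 by omega)]
    · rcases Nat.lt_succ_iff_lt_or_eq.1 hi with hlt | rfl
      · rw [← h i hlt]
        obtain ⟨d, rfl⟩ := Nat.exists_eq_add_of_lt hlt
        unfold ternaryDigit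
        rw [show j + 3 ^ (i + d + 1) * x (i + d + 1) =
          j + 3 ^ i * (3 * (3 ^ d * x (i + d + 1))) by ring,
          Nat.add_mul_div_left _ _ (by positivity), Nat.add_mul_mod_self_left]
      · unfold ternaryDigit
        rw [Nat.add_mul_div_left _ _ (by positivity), Nat.div_eq_of_lt hj, zero_add,
          Nat.mod_eq_of_lt (hx i)]

theorem exists_avoids_truncation {S : Set ℕ} {x : ℕ → ℕ} (hx : ∀ i, x i < 3) (h : Avoids S x)
    (N : ℕ) : ∃ j < 3 ^ N, Avoids S (ternaryDigit j) ∧ ∀ i < N, ternaryDigit j i = x i := by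
  obtain ⟨j, hj, hd⟩ := exists_ternaryDigit_eq x hx N
  refine ⟨j, hj, fun i e he hm => ?_, hd⟩
  have hN : i + (e + 1) < N := by
    by_contra hc
    exact hm.ne_zero le_rfl (ternaryDigit_eq_zero
      (hj.trans_le (Nat.pow_le_pow_right (by norm_num) (not_lt.1 hc))))
  exact h i e he (hm.congr fun k hk => (hd _ (by omega)).symm)

theorem exists_avoids_perSeq {S : Set ℕ} {x : ℕ → ℕ} (hx : ∀ i, x i < 3) (h : Avoids S x)
    (l : ℕ) : ∃ j, Avoids S (ternaryDigit j) ∧ ∀ i < l, perSeq j i = x i := by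
  set y : ℕ → ℕ := fun i => if i < l then x i else if i = l + 1 then 1 else 0 with hy
  have hy3 : ∀ i, y i < 3 := by
    intro i
    simp only [hy]
    split_ifs
    · exact hx i
    all_goals norm_num
  have hy2 : ∀ i, y i = 2 → i < l := by
    intro i hi
    by_contra hc
    simp only [hy, if_neg hc] at hi
    split_ifs at hi
    all_goals omega
  have hyx : ∀ i < l, y i = x i := fun i hi => by simp [hy, hi]
  have hya : Avoids S y := fun i e he hm => by
    have := hy2 _ hm.2.2
    exact h i e he (hm.congr fun k hk => (hyx _ (by omega)).symm)
  obtain ⟨j, -, hj, hd⟩ := exists_avoids_truncation hy3 hya (l + 2)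
  have hlj : l + 1 < j := by
    by_contra hc
    have h1 := hd (l + 1) (by omega)
    rw [ternaryDigit_eq_zero_of_le (not_lt.1 hc)] at h1
    simp [hy] at h1
  exact ⟨j, hj, fun i hi => by rw [perSeq_of_le (by omega), hd i (by omega), hyx i hi]⟩

theorem GoodAt.of_avoids {N j : ℕ} (h : Avoids HaltSet (ternaryDigit j)) : GoodAt N j :=
  goodAt_iff.2 (h.mono fun _ he => mem_HaltSet_iff.2 ⟨N, he⟩)

theorem eventually_goodAt_iff (j : ℕ) :
    ∀ᶠ N in atTop, GoodAt N j ↔ Avoids HaltSet (ternaryDigit j) := by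
  by_cases h : Avoids HaltSet (ternaryDigit j)
  · exact Eventually.of_forall fun N => ⟨fun _ => h, fun h => GoodAt.of_avoids h⟩
  · have h' := h
    unfold Avoids at h'
    push Not at h'
    obtain ⟨i, e, he, hm⟩ := h'
    obtain ⟨N, hN⟩ := mem_HaltSet_iff.1 he
    filter_upwards [eventually_ge_atTop N] with M hM
    exact ⟨fun hg => absurd hm (goodAt_iff.1 hg i e (haltedBy_mono hM hN)), fun hg => absurd hg h⟩

theorem eventually_forall_goodAt_iff (B : ℕ) :
    ∀ᶠ N in atTop, ∀ j < B, GoodAt N j ↔ Avoids HaltSet (ternaryDigit j) := by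
  have := (Finset.eventually_all (Finset.range B) (l := atTop)
    (p := fun j N => GoodAt N j ↔ Avoids HaltSet (ternaryDigit j))).2
    fun j _ => eventually_goodAt_iff j
  simpa using this

theorem ruler_eq_iff {m k : ℕ} : ruler m = k ↔ 2 ^ k ∣ m + 1 ∧ ¬ 2 ^ (k + 1) ∣ m + 1 := by
  have hlt : ∀ k, 2 ^ k ∣ m + 1 → k ≤ m := fun k hk => by
    have := Nat.le_of_dvd (by omega) hk
    have := Nat.lt_pow_self (n := k) (a := 2) (by norm_num)
    omega
  have hspec : 2 ^ ruler m ∣ m + 1 :=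
    Nat.findGreatest_spec (P := fun k => 2 ^ k ∣ m + 1) (Nat.zero_le m) (by simp)
  have hmax : ∀ k, 2 ^ k ∣ m + 1 → k ≤ ruler m := fun k hk =>
    Nat.le_findGreatest (P := fun k => 2 ^ k ∣ m + 1) (hlt k hk) hk
  constructor
  · rintro rfl
    exact ⟨hspec, fun h => by have := hmax _ h; omega⟩
  · rintro ⟨h1, h2⟩
    refine le_antisymm ?_ (hmax k h1)
    by_contra hc
    exact h2 ((pow_dvd_pow 2 (by omega)).trans hspec)

theorem two_pow_ruler_le (m : ℕ) : 2 ^ ruler m ≤ m + 1 :=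
  Nat.le_of_dvd (by omega) (ruler_eq_iff.1 rfl).1

theorem ruler_two_mul (m : ℕ) : ruler (2 * m) = 0 :=
  ruler_eq_iff.2 ⟨by simp, by simp⟩

theorem ruler_two_mul_add_one (m : ℕ) : ruler (2 * m + 1) = ruler m + 1 := by
  obtain ⟨h1, h2⟩ := ruler_eq_iff.1 (rfl : ruler m = ruler m)
  rw [ruler_eq_iff, show 2 * m + 1 + 1 = 2 * (m + 1) by ring, pow_succ' _ (ruler m),
    pow_succ' _ (ruler m + 1)]
  exact ⟨mul_dvd_mul_left _ h1, fun h => h2 (Nat.dvd_of_mul_dvd_mul_left (by norm_num) h)⟩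

theorem frequently_ruler_eq (j : ℕ) : ∃ᶠ m in atTop, ruler m = j := by
  induction j with
  | zero =>
    rw [frequently_atTop]
    exact fun a => ⟨2 * a, by omega, ruler_two_mul a⟩
  | succ j ih =>
    rw [frequently_atTop] at ih ⊢
    intro a
    obtain ⟨b, hb, h⟩ := ih a
    exact ⟨2 * b + 1, by omega, by rw [ruler_two_mul_add_one, h]⟩

/-- The point of `[0,1]` with base seven digits `2 x₀, 2 x₁, …`. -/
noncomputable def digitPoint (x : ℕ → ℕ) : ℝ := ∑' i, 2 * (x i : ℝ) / 7 ^ (i + 1)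

theorem digitPoint_summand_le {x : ℕ → ℕ} (hx : ∀ i, x i < 3) (i : ℕ) :
    2 * (x i : ℝ) / 7 ^ (i + 1) ≤ 4 / 7 * (1 / 7) ^ i := by
  have h : (x i : ℝ) ≤ 2 := by exact_mod_cast Nat.lt_succ_iff.1 (hx i)
  have : (4 / 7 * (1 / 7) ^ i : ℝ) = 4 / 7 ^ (i + 1) := by
    rw [pow_succ, div_pow, one_pow]; field_simp
  rw [this]
  gcongr
  linarith

theorem summable_digitPoint {x : ℕ → ℕ} (hx : ∀ i, x i < 3) :
    Summable fun i => 2 * (x i : ℝ) / 7 ^ (i + 1) :=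
  Summable.of_nonneg_of_le (fun i => by positivity) (digitPoint_summand_le hx)
    ((summable_geometric_of_lt_one (by norm_num) (by norm_num)).mul_left _)

theorem digitPoint_nonneg (x : ℕ → ℕ) : 0 ≤ digitPoint x :=
  tsum_nonneg fun i => by positivity

theorem digitPoint_le {x : ℕ → ℕ} (hx : ∀ i, x i < 3) : digitPoint x ≤ 2 / 3 := by
  have h := (summable_digitPoint hx).tsum_le_tsum (digitPoint_summand_le hx)
    ((summable_geometric_of_lt_one (by norm_num) (by norm_num)).mul_left _)
  rw [tsum_mul_left, tsum_geometric_of_lt_one (by norm_num) (by norm_num)] at h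
  exact h.trans (by norm_num)

theorem digitPoint_mem_Icc {x : ℕ → ℕ} (hx : ∀ i, x i < 3) : digitPoint x ∈ Icc (0 : ℝ) 1 :=
  ⟨digitPoint_nonneg x, (digitPoint_le hx).trans (by norm_num)⟩

theorem seven_mul_digitPoint {x : ℕ → ℕ} (hx : ∀ i, x i < 3) :
    7 * digitPoint x = 2 * x 0 + digitPoint fun i => x (i + 1) := by
  unfold digitPoint
  rw [(summable_digitPoint hx).tsum_eq_zero_add, mul_add, ← tsum_mul_left]
  congr 1
  · field_simp
    ring
  · refine tsum_congr fun i => ?_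
    rw [pow_succ]
    field_simp

theorem seven_pow_mul_digitPoint {x : ℕ → ℕ} (hx : ∀ i, x i < 3) (N : ℕ) :
    7 ^ N * digitPoint x = prefixVal x N + digitPoint fun i => x (i + N) := by
  induction N with
  | zero => simp [prefixVal]
  | succ N ih =>
    have h := seven_mul_digitPoint (x := fun i => x (i + N)) (fun i => hx _)
    rw [pow_succ', mul_assoc, ih, prefixVal, mul_add, h]
    push_cast
    simp only [zero_add, add_right_comm _ 1 N]
    simp only [← add_assoc]

theorem prefixVal_congr {x y : ℕ → ℕ} {N : ℕ} (h : ∀ i < N, x i = y i) :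
    prefixVal x N = prefixVal y N := by
  induction N with
  | zero => rfl
  | succ N ih => rw [prefixVal, prefixVal, ih fun i hi => h i (by omega), h N (by omega)]

theorem abs_digitPoint_sub_prefixVal_le {x : ℕ → ℕ} (hx : ∀ i, x i < 3) (N : ℕ) :
    (prefixVal x N : ℝ) / 7 ^ N ≤ digitPoint x ∧
      digitPoint x < ((prefixVal x N : ℝ) + 1) / 7 ^ N := by
  have h := seven_pow_mul_digitPoint hx N
  have h0 := digitPoint_nonneg fun i => x (i + N)
  have h1 := digitPoint_le (x := fun i => x (i + N)) fun i => hx _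
  rw [div_le_iff₀ (by positivity), lt_div_iff₀ (by positivity)]
  constructor <;> linarith

theorem abs_digitPoint_sub_le {x y : ℕ → ℕ} (hx : ∀ i, x i < 3) (hy : ∀ i, y i < 3) {N : ℕ}
    (h : ∀ i < N, x i = y i) : |digitPoint x - digitPoint y| < 1 / 7 ^ N := by
  have h1 := abs_digitPoint_sub_prefixVal_le hx N
  have h2 := abs_digitPoint_sub_prefixVal_le hy N
  rw [prefixVal_congr h, add_div] at h1
  rw [add_div] at h2
  rw [abs_lt]
  constructor <;> linarith

/-- The minimum of `y` with the tent over `[0, 2]` with floor `r`. -/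
def tent (y r : ℝ) : ℝ := min y (max (2 - y) r)

/-- Three tents of slope seven, with the value `c` to the right of them. -/
def threeTent (c x : ℝ) : ℝ := tent (7 * x) (tent (7 * x - 2) (tent (7 * x - 4) c))

theorem tent_of_le_one {y : ℝ} (h : y ≤ 1) (r : ℝ) : tent y r = y :=
  min_eq_left (le_max_of_le_left (by linarith))

theorem tent_of_two_le {y r : ℝ} (h : 2 ≤ y) (h0 : 0 ≤ r) (h1 : r ≤ 2) : tent y r = r := by
  rw [tent, max_eq_right (by linarith), min_eq_right (by linarith)]

theorem abs_tent_sub_tent_le (y r y' r' : ℝ) :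
    |tent y r - tent y' r'| ≤ max |y - y'| |r - r'| := by
  refine (abs_min_sub_min_le_max _ _ _ _).trans (max_le (le_max_left _ _) ?_)
  refine (abs_max_sub_max_le_max _ _ _ _).trans (max_le ?_ (le_max_right _ _))
  rw [show 2 - y - (2 - y') = -(y - y') by ring, abs_neg]
  exact le_max_left _ _

theorem tent_le_one {y r : ℝ} (hr : r ≤ 1) : tent y r ≤ 1 := by
  rcases le_total y 1 with h | h
  · exact (min_le_left _ _).trans h
  · exact (min_le_right _ _).trans (max_le (by linarith) hr)

theorem tent_nonneg {y r : ℝ} (hy : 0 ≤ y) (hr : 2 ≤ y → 0 ≤ r) : 0 ≤ tent y r := by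
  refine le_min hy ?_
  rcases le_total y 2 with h | h
  · exact le_max_of_le_left (by linarith)
  · exact le_max_of_le_right (hr h)

theorem tent_cases (y r : ℝ) : tent y r = y ∨ tent y r = 2 - y ∨ tent y r = r := by
  unfold tent
  rcases min_choice y (max (2 - y) r) with h | h
  · exact Or.inl h
  · rcases max_choice (2 - y) r with h' | h' <;> rw [h, h'] <;> simp

theorem abs_threeTent_sub_le (c x c' x' : ℝ) :
    |threeTent c x - threeTent c' x'| ≤ max (7 * |x - x'|) |c - c'| := by
  have h7 : |7 * x - 7 * x'| = 7 * |x - x'| := by rw [← mul_sub, abs_mul]; norm_num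
  refine (abs_tent_sub_tent_le _ _ _ _).trans (max_le (h7.le.trans (le_max_left _ _)) ?_)
  refine (abs_tent_sub_tent_le _ _ _ _).trans (max_le ?_ ?_)
  · rw [sub_sub_sub_cancel_right]; exact h7.le.trans (le_max_left _ _)
  refine (abs_tent_sub_tent_le _ _ _ _).trans (max_le ?_ (le_max_right _ _))
  rw [sub_sub_sub_cancel_right]; exact h7.le.trans (le_max_left _ _)

theorem continuous_threeTent (c : ℝ) : Continuous (threeTent c) := by
  unfold threeTent tent
  fun_prop

theorem threeTent_mem_Icc {c x : ℝ} (hc : c ∈ Icc (0 : ℝ) 1) (hx : 0 ≤ x) :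
    threeTent c x ∈ Icc (0 : ℝ) 1 := by
  refine ⟨tent_nonneg (by linarith) fun _ => tent_nonneg (by linarith) fun _ =>
    tent_nonneg (by linarith) fun _ => hc.1, tent_le_one (tent_le_one (tent_le_one hc.2))⟩

theorem threeTent_digitPoint (c : ℝ) {x : ℕ → ℕ} (hx : ∀ i, x i < 3) :
    threeTent c (digitPoint x) = digitPoint fun i => x (i + 1) := by
  have h := seven_mul_digitPoint hx
  have h0 := digitPoint_nonneg fun i => x (i + 1)
  have h1 := digitPoint_le (x := fun i => x (i + 1)) fun i => hx _
  set t := digitPoint fun i => x (i + 1)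
  have h3 := hx 0
  unfold threeTent
  rw [h]
  interval_cases x 0
  · rw [tent_of_le_one (by push_cast; linarith)]; simp
  · rw [tent_of_le_one (y := _ - 2) (by push_cast; linarith)]
    rw [tent_of_two_le] <;> push_cast <;> linarith
  · rw [tent_of_le_one (y := _ - 4) (by push_cast; linarith)]
    rw [tent_of_two_le (y := _ - 2), tent_of_two_le] <;> push_cast <;> (try ring_nf) <;> linarith

theorem threeTent_iterate_digitPoint (c : ℝ) {x : ℕ → ℕ}
    (hx : ∀ i, x i < 3) (n : ℕ) :
    (threeTent c)^[n] (digitPoint x) = digitPoint fun i => x (i + n) := by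
  induction n with
  | zero => simp
  | succ n ih =>
    rw [Function.iterate_succ_apply', ih, threeTent_digitPoint c fun i => hx _]
    simp only [add_right_comm _ 1 n, ← add_assoc]

theorem threeTent_cases {c x : ℝ} (h : threeTent c x ≠ c) :
    ∃ p ∈ ({(7, 0), (-7, 2), (7, -2), (-7, 4), (7, -4), (-7, 6)} : Finset (ℝ × ℝ)),
      threeTent c x = p.1 * x + p.2 := by
  simp only [Finset.mem_insert, Finset.mem_singleton, exists_eq_or_imp, exists_eq_left]
  unfold threeTent at *
  rcases tent_cases (7 * x) (tent (7 * x - 2) (tent (7 * x - 4) c)) with h1 | h1 | h1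
  · left; rw [h1]; ring
  · right; left; rw [h1]; ring
  rw [h1] at h ⊢
  rcases tent_cases (7 * x - 2) (tent (7 * x - 4) c) with h2 | h2 | h2
  · right; right; left; rw [h2]; ring
  · right; right; right; left; rw [h2]; ring
  rw [h2] at h ⊢
  rcases tent_cases (7 * x - 4) c with h3 | h3 | h3
  · right; right; right; right; left; rw [h3]; ring
  · right; right; right; right; right; rw [h3]; ring
  · exact absurd h3 h

theorem volume_preimage_affine {a : ℝ} (ha : |a| = 7) (b : ℝ) (s : Set ℝ) :
    volume ((fun x => a * x + b) ⁻¹' s) = (7 : ℝ≥0∞)⁻¹ * volume s := by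
  have ha0 : a ≠ 0 := by rintro rfl; norm_num at ha
  have h : (fun x => a * x + b) ⁻¹' s = (a * ·) ⁻¹' ((· + b) ⁻¹' s) := rfl
  rw [h, Real.volume_preimage_mul_left ha0, measure_preimage_add_right, abs_inv, ha,
    ENNReal.ofReal_inv_of_pos (by norm_num)]
  norm_num

theorem volume_never_hit {c : ℝ} (hc : c ∈ Icc (0 : ℝ) 1) :
    volume {x | x ∈ Icc (0 : ℝ) 1 ∧ ∀ n, (threeTent c)^[n + 1] x ≠ c} = 0 := by
  set N := {x | x ∈ Icc (0 : ℝ) 1 ∧ ∀ n, (threeTent c)^[n + 1] x ≠ c} with hN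
  set P : Finset (ℝ × ℝ) := {(7, 0), (-7, 2), (7, -2), (-7, 4), (7, -4), (-7, 6)} with hP
  have hsub : N ⊆ ⋃ p ∈ P, (fun x => p.1 * x + p.2) ⁻¹' N := by
    rintro x ⟨hx, hxn⟩
    obtain ⟨p, hp, hpx⟩ := threeTent_cases (hxn 0)
    simp only [mem_iUnion]
    refine ⟨p, hp, ?_⟩
    rw [mem_preimage, ← hpx]
    exact ⟨threeTent_mem_Icc hc hx.1, fun n => hxn (n + 1)⟩
  have hPa : ∀ p ∈ P, |p.1| = 7 := by
    intro p hp
    simp only [hP, Finset.mem_insert, Finset.mem_singleton] at hp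
    rcases hp with rfl | rfl | rfl | rfl | rfl | rfl <;> norm_num
  have hcard : P.card ≤ 6 := by
    rw [hP]; exact Finset.card_le_six
  have hle : volume N ≤ 6 * ((7 : ℝ≥0∞)⁻¹ * volume N) := by
    refine (measure_mono hsub).trans ((measure_biUnion_finset_le _ _).trans ?_)
    rw [Finset.sum_congr rfl fun p hp => volume_preimage_affine (hPa p hp) p.2 N,
      Finset.sum_const, nsmul_eq_mul]
    gcongr
    exact_mod_cast hcard
  have hfin : volume N ≠ ∞ := by
    refine ne_top_of_le_ne_top ?_ (measure_mono (t := Icc (0 : ℝ) 1) fun x hx => hx.1)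
    simp
  lift volume N to ℝ≥0 using hfin with v
  have h7 : ((7 : ℝ≥0∞)⁻¹) = ((7⁻¹ : ℝ≥0) : ℝ≥0∞) := by
    rw [ENNReal.coe_inv (by norm_num)]; norm_num
  rw [h7] at hle
  have hle' : v ≤ 6 * (7⁻¹ * v) := by exact_mod_cast hle
  have hle'' : (v : ℝ) ≤ 6 * (7⁻¹ * v) := by exact_mod_cast hle'
  have : (v : ℝ) ≤ 0 := by linarith
  have : v = 0 := le_antisymm (by exact_mod_cast this) (zero_le)
  simp [this]

theorem ae_exists_iterate_eq {c : ℝ} (hc : c ∈ Icc (0 : ℝ) 1) :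
    ∀ᵐ x ∂(volume.restrict (Icc (0 : ℝ) 1)), ∃ k, (threeTent c)^[k] x = c := by
  rw [ae_restrict_iff' measurableSet_Icc]
  have h : ∀ᵐ x, ¬ (x ∈ Icc (0 : ℝ) 1 ∧ ∀ n, (threeTent c)^[n + 1] x ≠ c) := by
    rw [ae_iff]
    simpa only [not_not] using volume_never_hit hc
  filter_upwards [h] with x hx hI
  push Not at hx
  obtain ⟨n, hn⟩ := hx hI
  exact ⟨_, hn⟩

theorem computable_rat_num_neg : Computable fun q : ℚ => (-q.num).toNat := by
  have h : Primrec fun k : ℕ => if k.unpair.1 % 2 = 0 then 0 else (k.unpair.1 + 1) / 2 :=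
    Primrec.ite (Primrec.eq.comp (Primrec.nat_mod.comp (Primrec.fst.comp Primrec.unpair)
      (Primrec.const 2)) (Primrec.const 0)) (Primrec.const 0)
      (Primrec.nat_div.comp (Primrec.succ.comp (Primrec.fst.comp Primrec.unpair))
        (Primrec.const 2))
  refine (h.to_comp.comp computable_ratPairCode).of_eq fun q => ?_
  rw [ratPairCode_eq]
  simp only [Nat.unpair_pair]
  cases q.num with
  | ofNat n =>
    have : Encodable.encode (Int.ofNat n) = 2 * n := rfl
    rw [this, if_pos (by omega)]; simp
  | negSucc n =>
    have : Encodable.encode (Int.negSucc n) = 2 * n + 1 := rfl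
    rw [this, if_neg (by omega)]; simp; omega

/-- A rational as the triple of positive part of the numerator, negative part, denominator. -/
def ratSplit (q : ℚ) : ℕ × ℕ × ℕ := (q.num.toNat, (-q.num).toNat, q.den)

theorem computable_ratSplit : Computable ratSplit :=
  computable_rat_num.pair (computable_rat_num_neg.pair computable_rat_den)

/-- The value of a triple as a fraction. -/
noncomputable def fracVal (s : ℕ × ℕ × ℕ) : ℝ := ((s.1 : ℝ) - s.2.1) / s.2.2

/-- Comparison of fractions given by triples. -/
def FracLt (s t : ℕ × ℕ × ℕ) : Prop :=
  s.1 * t.2.2 + t.2.1 * s.2.2 < t.1 * s.2.2 + s.2.1 * t.2.2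

theorem fracVal_ratSplit (q : ℚ) : fracVal (ratSplit q) = q := by
  have h : ((q.num.toNat : ℝ) - ((-q.num).toNat : ℝ)) = (q.num : ℝ) := by
    have : ((q.num.toNat : ℤ) - ((-q.num).toNat : ℤ)) = q.num := Int.toNat_sub_toNat_neg _
    exact_mod_cast congrArg (Int.cast : ℤ → ℝ) this
  simp only [fracVal, ratSplit]
  rw [h, ← Rat.cast_def]

theorem ratSplit_pos (q : ℚ) : 0 < (ratSplit q).2.2 := q.pos

theorem fracLt_iff {s t : ℕ × ℕ × ℕ} (hs : 0 < s.2.2) (ht : 0 < t.2.2) :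
    FracLt s t ↔ fracVal s < fracVal t := by
  have hs' : (0 : ℝ) < s.2.2 := by exact_mod_cast hs
  have ht' : (0 : ℝ) < t.2.2 := by exact_mod_cast ht
  rw [fracVal, fracVal, div_lt_div_iff₀ hs' ht', FracLt, ← Nat.cast_lt (α := ℝ)]
  push_cast
  constructor <;> intro h <;> linarith

theorem primrec_fracLt : PrimrecRel FracLt := by
  have h1 {α : Type} [Primcodable α] {f : α → ℕ × ℕ × ℕ} (hf : Primrec f) :
      Primrec fun a => (f a).2.1 := Primrec.fst.comp (Primrec.snd.comp hf)
  have h2 {α : Type} [Primcodable α] {f : α → ℕ × ℕ × ℕ} (hf : Primrec f) :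
      Primrec fun a => (f a).2.2 := Primrec.snd.comp (Primrec.snd.comp hf)
  exact Primrec.nat_lt.comp
    (Primrec.nat_add.comp
      (Primrec.nat_mul.comp (Primrec.fst.comp Primrec.fst) (h2 Primrec.snd))
      (Primrec.nat_mul.comp (h1 Primrec.snd) (h2 Primrec.fst)))
    (Primrec.nat_add.comp
      (Primrec.nat_mul.comp (Primrec.fst.comp Primrec.snd) (h2 Primrec.fst))
      (Primrec.nat_mul.comp (h1 Primrec.fst) (h2 Primrec.snd)))

/-- The point with base seven expansion `2 · perSeq j`, of period `j + 1` under the shift. -/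
noncomputable def perPoint (j i : ℕ) : ℝ := digitPoint fun n => perSeq j (n + i)

/-- The closure of the periodic points whose period word avoids all words `2 1ᵉ 2`, `e ∈ S`. -/
def attractorOf (S : Set ℕ) : Set ℝ :=
  closure {y | ∃ j i, Avoids S (ternaryDigit j) ∧ y = perPoint j i}

theorem perPoint_mem_Icc (j i : ℕ) : perPoint j i ∈ Icc (0 : ℝ) 1 :=
  digitPoint_mem_Icc fun _ => perSeq_lt _ _

theorem perPoint_mem_attractorOf {S : Set ℕ} {j : ℕ} (h : Avoids S (ternaryDigit j)) (i : ℕ) :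
    perPoint j i ∈ attractorOf S := subset_closure ⟨j, i, h, rfl⟩

theorem isClosed_attractorOf (S : Set ℕ) : IsClosed (attractorOf S) := isClosed_closure

theorem attractorOf_subset (S : Set ℕ) : attractorOf S ⊆ Icc (0 : ℝ) 1 := by
  refine closure_minimal ?_ isClosed_Icc
  rintro y ⟨j, i, -, rfl⟩
  exact perPoint_mem_Icc j i

theorem threeTent_perPoint (c : ℝ) (j i : ℕ) :
    threeTent c (perPoint j i) = perPoint j (i + 1) := by
  rw [perPoint, threeTent_digitPoint c fun n => perSeq_lt _ _, perPoint]
  simp only [add_right_comm _ 1 i, ← add_assoc]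

theorem perPoint_add_period (j i : ℕ) : perPoint j (i + (j + 1)) = perPoint j i := by
  simp only [perPoint, ← add_assoc _ i, perSeq_add_period]

theorem perPoint_mod (j i : ℕ) : perPoint j (i % (j + 1)) = perPoint j i := by
  unfold perPoint perSeq
  simp

theorem mapsTo_attractorOf (c : ℝ) (S : Set ℕ) :
    MapsTo (threeTent c) (attractorOf S) (attractorOf S) := by
  refine MapsTo.closure ?_ (continuous_threeTent c)
  rintro y ⟨j, i, h, rfl⟩
  exact ⟨j, i + 1, h, threeTent_perPoint c j i⟩

theorem exists_seven_pow_lt {ε : ℝ} (hε : 0 < ε) : ∃ N : ℕ, 1 / (7 : ℝ) ^ N < ε := by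
  obtain ⟨N, hN⟩ := exists_pow_lt_of_lt_one hε (y := (1 / 7 : ℝ)) (by norm_num)
  exact ⟨N, by rwa [div_pow, one_pow] at hN⟩

theorem digitPoint_mem_attractorOf {S : Set ℕ} {x : ℕ → ℕ} (hx : ∀ i, x i < 3)
    (h : Avoids S x) : digitPoint x ∈ attractorOf S := by
  refine Metric.mem_closure_iff.2 fun ε hε => ?_
  obtain ⟨N, hN⟩ := exists_seven_pow_lt hε
  obtain ⟨j, hj, hd⟩ := exists_avoids_perSeq hx h N
  refine ⟨perPoint j 0, ⟨j, 0, hj, rfl⟩, ?_⟩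
  rw [Real.dist_eq]
  exact (abs_digitPoint_sub_le hx (fun i => perSeq_lt _ _) fun i hi => (hd i hi).symm).trans hN

theorem mem_biUnion_of_mem_attractorOf {S : Set ℕ} (N : ℕ) {y : ℝ} (hy : y ∈ attractorOf S) :
    ∃ j < 3 ^ N, Avoids S (ternaryDigit j) ∧
      y ∈ Icc ((prefixVal (ternaryDigit j) N : ℝ) / 7 ^ N)
        (((prefixVal (ternaryDigit j) N : ℝ) + 1) / 7 ^ N) := by
  set F : Finset ℕ := by
    classical exact (Finset.range (3 ^ N)).filter fun j => Avoids S (ternaryDigit j)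
  have hF : ∀ j, j ∈ F ↔ j < 3 ^ N ∧ Avoids S (ternaryDigit j) := by
    intro j; simp [F]
  have hsub : attractorOf S ⊆ ⋃ j ∈ F, Icc ((prefixVal (ternaryDigit j) N : ℝ) / 7 ^ N)
      (((prefixVal (ternaryDigit j) N : ℝ) + 1) / 7 ^ N) := by
    refine closure_minimal ?_ (isClosed_biUnion_finset fun _ _ => isClosed_Icc)
    rintro y ⟨j, i, h, rfl⟩
    have hx : ∀ n, perSeq j (n + i) < 3 := fun n => perSeq_lt _ _
    obtain ⟨k, hk, hka, hkd⟩ := exists_avoids_truncation hx (h.perSeq.shift i) N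
    have hb := abs_digitPoint_sub_prefixVal_le hx N
    rw [prefixVal_congr fun n hn => (hkd n hn).symm] at hb
    simp only [mem_iUnion]
    exact ⟨k, (hF k).2 ⟨hk, hka⟩, hb.1, hb.2.le⟩
  have := hsub hy
  simp only [mem_iUnion] at this
  obtain ⟨j, hj, h⟩ := this
  exact ⟨j, ((hF j).1 hj).1, ((hF j).1 hj).2, h⟩

theorem Icc_inter_attractorOf_eq_empty_iff {a b : ℝ} (hab : a < b) :
    Icc a b ∩ attractorOf HaltSet = ∅ ↔ ∃ N M, ∀ j < 3 ^ N, GoodAt M j →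
      b < (prefixVal (ternaryDigit j) N : ℝ) / 7 ^ N ∨
      ((prefixVal (ternaryDigit j) N : ℝ) + 1) / 7 ^ N < a := by
  constructor
  · intro h
    have hsub : Icc a b ⊆ (attractorOf HaltSet)ᶜ := by
      rw [← disjoint_iff_inter_eq_empty] at h
      exact h.subset_compl_right
    obtain ⟨δ, hδ, hδs⟩ := isCompact_Icc.exists_cthickening_subset_open
      (isClosed_attractorOf HaltSet).isOpen_compl hsub
    obtain ⟨N, hN⟩ := exists_seven_pow_lt hδ
    obtain ⟨M, hM⟩ := (eventually_forall_goodAt_iff (3 ^ N)).exists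
    refine ⟨N, M, fun j hj hg => ?_⟩
    by_contra hc
    push Not at hc
    have hlt := ternaryDigit_lt j
    have hmem := digitPoint_mem_attractorOf hlt ((hM j hj).1 hg)
    have hb := abs_digitPoint_sub_prefixVal_le hlt N
    refine hδs ?_ hmem
    set v := (prefixVal (ternaryDigit j) N : ℝ)
    have h1 : (v + 1) / 7 ^ N = v / 7 ^ N + 1 / 7 ^ N := add_div _ _ _
    refine Metric.mem_cthickening_of_dist_le _ (max a (v / 7 ^ N)) _ _
      ⟨le_max_left _ _, max_le hab.le hc.1⟩ ?_
    have h2 : max a (v / 7 ^ N) ≤ (v + 1) / 7 ^ N := by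
      refine max_le hc.2 ?_
      rw [h1]
      have : (0 : ℝ) < 1 / 7 ^ N := by positivity
      linarith
    have h3 := le_max_right a (v / 7 ^ N)
    rw [Real.dist_eq, abs_le]
    constructor <;> linarith
  · rintro ⟨N, M, h⟩
    rw [Set.eq_empty_iff_forall_notMem]
    rintro y ⟨hy, hyA⟩
    obtain ⟨j, hj, hja, h1, h2⟩ := mem_biUnion_of_mem_attractorOf N hyA
    rcases h j hj (GoodAt.of_avoids hja) with h3 | h3
    · exact absurd hy.2 (not_le.2 (h3.trans_le h1))
    · exact absurd hy.1 (not_le.2 (h2.trans_lt h3))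

theorem sigmaOne_outer :
    SigmaOne {p : ℚ × ℚ | p.1 < p.2 ∧
      Icc (p.1 : ℝ) (p.2 : ℝ) ∩ attractorOf HaltSet = ∅} := by
  classical
  let R : ((ℕ × ℕ × ℕ) × (ℕ × ℕ × ℕ)) × ℕ → Prop := fun q =>
    FracLt q.1.1 q.1.2 ∧ ∀ j < 3 ^ q.2.unpair.1, GoodAt q.2.unpair.2 j →
      FracLt q.1.2 (prefixVal (ternaryDigit j) q.2.unpair.1, 0, 7 ^ q.2.unpair.1) ∨
      FracLt (prefixVal (ternaryDigit j) q.2.unpair.1 + 1, 0, 7 ^ q.2.unpair.1) q.1.1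
  have hN : Primrec fun q : ((ℕ × ℕ × ℕ) × (ℕ × ℕ × ℕ)) × ℕ => q.2.unpair.1 :=
    Primrec.fst.comp (Primrec.unpair.comp Primrec.snd)
  have hM : Primrec fun q : ((ℕ × ℕ × ℕ) × (ℕ × ℕ × ℕ)) × ℕ => q.2.unpair.2 :=
    Primrec.snd.comp (Primrec.unpair.comp Primrec.snd)
  have hv : Primrec fun r : (((ℕ × ℕ × ℕ) × (ℕ × ℕ × ℕ)) × ℕ) × ℕ =>
      prefixVal (ternaryDigit r.2) r.1.2.unpair.1 :=
    (Primrec₂.prefixVal primrec_ternaryDigit).comp Primrec.snd (hN.comp Primrec.fst)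
  have h7 : Primrec fun r : (((ℕ × ℕ × ℕ) × (ℕ × ℕ × ℕ)) × ℕ) × ℕ => 7 ^ r.1.2.unpair.1 :=
    primrec_nat_pow.comp (Primrec.const 7) (hN.comp Primrec.fst)
  have hR : PrimrecPred R := by
    refine (primrec_fracLt.comp (Primrec.fst.comp Primrec.fst)
      (Primrec.snd.comp Primrec.fst)).and (PrimrecPred.forall_lt_comp (p := fun r =>
        GoodAt r.1.2.unpair.2 r.2 →
        FracLt r.1.1.2 (prefixVal (ternaryDigit r.2) r.1.2.unpair.1, 0, 7 ^ r.1.2.unpair.1) ∨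
        FracLt (prefixVal (ternaryDigit r.2) r.1.2.unpair.1 + 1, 0, 7 ^ r.1.2.unpair.1)
          r.1.1.1) ?_ (primrec_nat_pow.comp (Primrec.const 3) hN))
    have hg := (primrec_goodAt.comp (hM.comp Primrec.fst)
      (Primrec.snd (α := ((ℕ × ℕ × ℕ) × (ℕ × ℕ × ℕ)) × ℕ) (β := ℕ))).not
    have h1 := primrec_fracLt.comp (Primrec.snd.comp (Primrec.fst.comp Primrec.fst))
      (hv.pair ((Primrec.const 0).pair h7))
    have h2 := primrec_fracLt.comp ((Primrec.succ.comp hv).pair ((Primrec.const 0).pair h7))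
      (Primrec.fst.comp (Primrec.fst.comp Primrec.fst))
    exact (hg.or (h1.or h2)).of_eq fun r => by
      rw [imp_iff_not_or]
  refine ⟨fun p => decide (R ((ratSplit p.1.1, ratSplit p.1.2), p.2)), ?_, fun p => ?_⟩
  · exact hR.decide.to_comp.comp
      (((computable_ratSplit.comp (Computable.fst.comp Computable.fst)).pair
        (computable_ratSplit.comp (Computable.snd.comp Computable.fst))).pair Computable.snd)
  · have hlt : FracLt (ratSplit p.1) (ratSplit p.2) ↔ p.1 < p.2 := by
      rw [fracLt_iff (ratSplit_pos _) (ratSplit_pos _), fracVal_ratSplit, fracVal_ratSplit,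
        Rat.cast_lt]
    simp only [R, decide_eq_true_eq]
    rw [mem_ofPred_eq, hlt]
    have hval : ∀ v N : ℕ, fracVal (v, 0, 7 ^ N) = (v : ℝ) / 7 ^ N := by
      intro v N; simp [fracVal]
    have hpos : ∀ v N : ℕ, 0 < ((v, 0, 7 ^ N) : ℕ × ℕ × ℕ).2.2 := fun v N => by positivity
    simp only [fracLt_iff (ratSplit_pos _) (hpos _ _), fracLt_iff (hpos _ _) (ratSplit_pos _),
      fracVal_ratSplit, hval]
    rw [exists_and_left]
    refine and_congr_right fun hp => ?_
    rw [Icc_inter_attractorOf_eq_empty_iff (Rat.cast_lt.2 hp)]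
    push_cast
    constructor
    · rintro ⟨N, M, h⟩
      exact ⟨Nat.pair N M, by simpa using h⟩
    · rintro ⟨t, h⟩
      exact ⟨_, _, h⟩

/-- The word `2 1ᵉ 2` followed by zeros. -/
def markerWord (e i : ℕ) : ℕ := if i = 0 ∨ i = e + 1 then 2 else if i ≤ e then 1 else 0

theorem markerWord_lt (e i : ℕ) : markerWord e i < 3 := by
  unfold markerWord; split_ifs <;> norm_num

theorem markerAt_markerWord (e : ℕ) : MarkerAt (markerWord e) 0 e := by
  refine ⟨by simp [markerWord], fun k hk => ?_, ?_⟩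
  · unfold markerWord
    rw [if_neg (by omega), if_pos (by omega)]
  · unfold markerWord
    rw [if_pos (by omega)]

theorem eq_of_markerAt_markerWord {e i d : ℕ} (h : MarkerAt (markerWord e) i d) : d = e := by
  have h0 := h.1
  have h2 := h.2.2
  unfold markerWord at h0 h2
  split_ifs at h0 h2 <;> omega

theorem primrec_markerWord : Primrec₂ markerWord := by
  have hs : Primrec fun p : ℕ × ℕ => p.1 + 1 := Primrec.succ.comp Primrec.fst
  exact Primrec.ite ((Primrec.eq.comp Primrec.snd (Primrec.const 0)).or
    (Primrec.eq.comp Primrec.snd hs)) (Primrec.const 2)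
    (Primrec.ite (Primrec.nat_le.comp Primrec.snd Primrec.fst) (Primrec.const 1)
      (Primrec.const 0))

theorem prefixVal_injective {x y : ℕ → ℕ} (hx : ∀ i, x i < 3) (hy : ∀ i, y i < 3) {N : ℕ}
    (h : prefixVal x N = prefixVal y N) : ∀ i < N, x i = y i := by
  induction N with
  | zero => simp
  | succ N ih =>
    have h1 := hx N
    have h2 := hy N
    simp only [prefixVal] at h
    intro i hi
    rcases Nat.lt_succ_iff_lt_or_eq.1 hi with hlt | rfl
    · exact ih (by omega) i hlt
    · omega

theorem even_prefixVal (x : ℕ → ℕ) (N : ℕ) : Even (prefixVal x N) := by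
  induction N with
  | zero => exact ⟨0, rfl⟩
  | succ N ih => exact (ih.mul_left 7).add ⟨x N, by ring⟩

/-- A rational interval around the points whose expansion starts with `2 1ᵉ 2`. -/
def markerInterval (e : ℕ) : ℚ × ℚ :=
  ((((prefixVal (markerWord e) (e + 2) - 1 : ℕ) : ℚ) / ((7 ^ (e + 2) - 1 + 1 : ℕ) : ℚ)),
    (((prefixVal (markerWord e) (e + 2) + 1 : ℕ) : ℚ) / ((7 ^ (e + 2) - 1 + 1 : ℕ) : ℚ)))

theorem primrec_markerInterval : Primrec markerInterval := by
  have hs : Primrec fun e : ℕ => e + 2 := Primrec.nat_add.comp Primrec.id (Primrec.const 2)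
  have hv : Primrec fun e : ℕ => prefixVal (markerWord e) (e + 2) :=
    (Primrec₂.prefixVal primrec_markerWord).comp Primrec.id hs
  have hD : Primrec fun e : ℕ => 7 ^ (e + 2) - 1 :=
    Primrec.nat_sub.comp (primrec_nat_pow.comp (Primrec.const 7) hs) (Primrec.const 1)
  exact (primrec_rat_div.comp ((Primrec.nat_sub.comp hv (Primrec.const 1)).pair hD)).pair
    (primrec_rat_div.comp ((Primrec.succ.comp hv).pair hD))

theorem cast_markerInterval (e : ℕ) :
    ((markerInterval e).1 : ℝ) = ((prefixVal (markerWord e) (e + 2) : ℝ) - 1) / 7 ^ (e + 2) ∧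
    ((markerInterval e).2 : ℝ) = ((prefixVal (markerWord e) (e + 2) : ℝ) + 1) / 7 ^ (e + 2) := by
  have h1 : 1 ≤ prefixVal (markerWord e) (e + 2) := by
    have : markerWord e (e + 1) = 2 := by simp [markerWord]
    simp only [prefixVal, this]
    omega
  have h2 : 7 ^ (e + 2) - 1 + 1 = 7 ^ (e + 2) :=
    Nat.sub_add_cancel (Nat.one_le_pow _ _ (by norm_num))
  simp only [markerInterval, h2]
  push_cast [h1]
  exact ⟨rfl, rfl⟩

theorem half_lt_markerInterval (e : ℕ) : (1 / 2 : ℝ) < (markerInterval e).1 := by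
  rw [(cast_markerInterval e).1, lt_div_iff₀ (by positivity)]
  have h : ∀ n, 4 * 7 ^ n ≤ prefixVal (markerWord e) (n + 1) := by
    intro n
    induction n with
    | zero => simp [prefixVal, markerWord]
    | succ n ih =>
      rw [prefixVal, pow_succ]
      omega
  have h1 : (4 * 7 ^ (e + 1) : ℝ) ≤ prefixVal (markerWord e) (e + 2) := by exact_mod_cast h (e + 1)
  have h2 : (1 : ℝ) ≤ 7 ^ e := one_le_pow₀ (by norm_num)
  rw [pow_succ] at h1
  rw [pow_add]
  linarith

theorem Ioo_markerInterval_inter_nonempty_iff (e : ℕ) (S : Set ℕ) :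
    (Ioo ((markerInterval e).1 : ℝ) ((markerInterval e).2 : ℝ) ∩ attractorOf S).Nonempty ↔
      e ∉ S := by
  obtain ⟨h1, h2⟩ := cast_markerInterval e
  rw [h1, h2]
  constructor
  · rintro ⟨y, hy, hyA⟩ he
    obtain ⟨_, hz, j, i, hj, rfl⟩ := mem_closure_iff.1 hyA _ isOpen_Ioo hy
    have hx : ∀ n, perSeq j (n + i) < 3 := fun n => perSeq_lt _ _
    have hb := abs_digitPoint_sub_prefixVal_le hx (e + 2)
    have hz1 := hz.1.trans hb.2
    have hz2 := hb.1.trans_lt hz.2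
    rw [div_lt_div_iff_of_pos_right (by positivity)] at hz1 hz2
    have hz3 : prefixVal (fun n => perSeq j (n + i)) (e + 2) <
        prefixVal (markerWord e) (e + 2) + 1 := by exact_mod_cast hz2
    have hz4 : prefixVal (markerWord e) (e + 2) <
        prefixVal (fun n => perSeq j (n + i)) (e + 2) + 1 + 1 := by
      have := sub_lt_iff_lt_add.1 hz1
      exact_mod_cast this
    obtain ⟨a, ha⟩ := even_prefixVal (markerWord e) (e + 2)
    obtain ⟨b, hb⟩ := even_prefixVal (fun n => perSeq j (n + i)) (e + 2)
    have heq := prefixVal_injective hx (markerWord_lt e) (N := e + 2) (by omega)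
    exact hj.perSeq.shift i 0 e he ((markerAt_markerWord e).congr fun k hk => heq _ (by omega))
  · intro he
    have hA : Avoids S (markerWord e) := fun i d hd hm => he (eq_of_markerAt_markerWord hm ▸ hd)
    refine ⟨_, ?_, digitPoint_mem_attractorOf (markerWord_lt e) hA⟩
    have hb := abs_digitPoint_sub_prefixVal_le (markerWord_lt e) (e + 2)
    refine ⟨lt_of_lt_of_le ?_ hb.1, hb.2⟩
    gcongr
    linarith

theorem markerInterval_lt (e : ℕ) : (markerInterval e).1 < (markerInterval e).2 := by
  obtain ⟨h1, h2⟩ := cast_markerInterval e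
  rw [← Rat.cast_lt (K := ℝ), h1, h2]
  gcongr
  linarith

theorem manyOneReducible_inner :
    (fun e : ℕ => e ∉ HaltSet) ≤₀
      fun p : ℚ × ℚ => p.1 < p.2 ∧
        (Ioo (p.1 : ℝ) (p.2 : ℝ) ∩ attractorOf HaltSet).Nonempty :=
  ⟨markerInterval, primrec_markerInterval.to_comp, fun e =>
    ⟨fun he => ⟨markerInterval_lt e, (Ioo_markerInterval_inter_nonempty_iff e _).2 he⟩,
      fun h => (Ioo_markerInterval_inter_nonempty_iff e _).1 h.2⟩⟩

/-- The tent map with floor, scaled by `D` and truncated to the natural numbers. -/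
def tentNat (D Y R : ℕ) : ℕ := min Y (max (2 * D - Y) R)

theorem cast_tsub_div {D : ℕ} (hD : 0 < D) {a b : ℕ} :
    ((a - b : ℕ) : ℝ) / D = max ((a : ℝ) / D - b / D) 0 := by
  have hD' : (0 : ℝ) < D := by exact_mod_cast hD
  rcases le_total a b with h | h
  · have : (a : ℝ) / D ≤ b / D := by gcongr
    rw [Nat.sub_eq_zero_of_le h, max_eq_right (by linarith)]; simp
  · have : (b : ℝ) / D ≤ a / D := by gcongr
    rw [max_eq_left (by linarith), Nat.cast_sub h, sub_div]

theorem cast_tentNat_div {D Y R : ℕ} (hD : 0 < D) {y r : ℝ} (hY : (Y : ℝ) / D = max y 0)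
    (hR : (R : ℝ) / D = max r 0) : (tentNat D Y R : ℝ) / D = max (tent y r) 0 := by
  have hD' : (0 : ℝ) < D := by exact_mod_cast hD
  have h2 : ((2 * D - Y : ℕ) : ℝ) / D = max (2 - max y 0) 0 := by
    rw [cast_tsub_div hD, hY]
    push_cast
    rw [mul_div_cancel_right₀ _ hD'.ne']
  have : (tentNat D Y R : ℝ) / D = min (max y 0) (max (max (2 - max y 0) 0) (max r 0)) := by
    rw [tentNat, Nat.cast_min, Nat.cast_max, ← min_div_div_right hD'.le,
      ← max_div_div_right hD'.le, hY, h2, hR]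
  rw [this, tent]
  simp only [max_def, min_def]
  split_ifs <;> linarith

/-- The map `threeTent`, scaled by `D` and truncated to the natural numbers. -/
def threeTentNat (D C Y : ℕ) : ℕ :=
  tentNat D Y (tentNat D (Y - 2 * D) (tentNat D (Y - 4 * D) C))

theorem cast_threeTentNat_div {D C Y : ℕ} (hD : 0 < D) (hC : C ≤ D) :
    (threeTentNat D C Y : ℝ) / D = threeTent (C / D) (Y / D / 7) := by
  have hD' : (0 : ℝ) < D := by exact_mod_cast hD
  have hc : (C : ℝ) / D ∈ Icc (0 : ℝ) 1 :=
    ⟨by positivity, (div_le_one hD').2 (by exact_mod_cast hC)⟩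
  have hx : (0 : ℝ) ≤ Y / D / 7 := by positivity
  have h := (threeTent_mem_Icc hc hx).1
  have hsub : ∀ k : ℕ, ((Y - k * D : ℕ) : ℝ) / D = max (7 * (Y / D / 7 : ℝ) - k) 0 := by
    intro k
    rw [cast_tsub_div hD]
    push_cast
    rw [mul_div_cancel_right₀ _ hD'.ne', mul_div_cancel₀ _ (by norm_num : (7 : ℝ) ≠ 0)]
  have h0 : (Y : ℝ) / D = max (7 * (Y / D / 7 : ℝ)) 0 := by
    have := hsub 0
    simpa using this
  have h2 := hsub 2
  have h4 := hsub 4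
  push_cast at h2 h4
  rw [threeTentNat, cast_tentNat_div hD h0 (cast_tentNat_div hD h2
    (cast_tentNat_div hD h4 (max_eq_left hc.1).symm))]
  exact max_eq_left h

theorem Primrec.tentNat {α : Type*} [Primcodable α] {D Y R : α → ℕ} (hD : Primrec D)
    (hY : Primrec Y) (hR : Primrec R) : Primrec fun a => tentNat (D a) (Y a) (R a) :=
  Primrec.nat_min.comp hY (Primrec.nat_max.comp
    (Primrec.nat_sub.comp (Primrec.nat_mul.comp (Primrec.const 2) hD) hY) hR)

theorem Primrec.threeTentNat {α : Type*} [Primcodable α] {D C Y : α → ℕ} (hD : Primrec D)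
    (hC : Primrec C) (hY : Primrec Y) : Primrec fun a => threeTentNat (D a) (C a) (Y a) :=
  Primrec.tentNat hD hY (Primrec.tentNat hD
    (Primrec.nat_sub.comp hY (Primrec.nat_mul.comp (Primrec.const 2) hD))
    (Primrec.tentNat hD (Primrec.nat_sub.comp hY (Primrec.nat_mul.comp (Primrec.const 4) hD)) hC))

theorem cast_rat_max_zero (q : ℚ) : max (q : ℝ) 0 = (q.num.toNat : ℝ) / q.den := by
  have hd : (0 : ℝ) < q.den := by exact_mod_cast q.pos
  have h1 : (q : ℝ) = (q.num : ℝ) / q.den := Rat.cast_def q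
  have h2 : (q.num.toNat : ℝ) = max (q.num : ℝ) 0 := by
    have : ((q.num.toNat : ℤ) : ℝ) = ((max q.num 0 : ℤ) : ℝ) := by rw [Int.toNat_eq_max]
    rw [Int.cast_max] at this
    exact_mod_cast this
  rw [h2, h1, ← max_div_div_right hd.le, zero_div]

theorem computableRealMap_threeTent {x : ℕ → ℕ} (hxp : Primrec x) (hx : ∀ i, x i < 3) :
    ComputableRealMap (threeTent (digitPoint x)) := by
  let G : (ℕ × ℕ) × ℕ → ℕ := fun t => threeTentNat (7 ^ (t.2 + 1))
    (prefixVal x (t.2 + 1)) (7 * t.1.1 * 7 ^ (t.2 + 1) / t.1.2)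
  let F : (ℕ × ℕ) × ℕ → ℚ := fun t => (G t : ℚ) / ((7 ^ (t.2 + 1) - 1 + 1 : ℕ) : ℚ)
  have hF : Computable F := by
    have hD : Primrec fun n : ℕ => 7 ^ (n + 1) :=
      primrec_nat_pow.comp (Primrec.const 7) Primrec.succ
    have hv : Primrec fun n : ℕ => prefixVal x (n + 1) :=
      (Primrec₂.prefixVal (x := fun (_ : ℕ) => x) (hxp.comp Primrec.snd)).comp
        Primrec.id Primrec.succ
    have hG : Primrec G :=
      Primrec.threeTentNat (hD.comp Primrec.snd) (hv.comp Primrec.snd)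
        (Primrec.nat_div.comp (Primrec.nat_mul.comp
          (Primrec.nat_mul.comp (Primrec.const 7) (Primrec.fst.comp Primrec.fst))
          (hD.comp Primrec.snd)) (Primrec.snd.comp Primrec.fst))
    have hD1 : Primrec fun t : (ℕ × ℕ) × ℕ => 7 ^ (t.2 + 1) - 1 :=
      Primrec.nat_sub.comp (hD.comp Primrec.snd) (Primrec.const 1)
    exact (primrec_rat_div.comp (hG.pair hD1)).to_comp
  refine ⟨fun n => n + 4, fun p => F ((p.1.num.toNat, p.1.den), p.2),
    (Primrec.nat_add.comp Primrec.id (Primrec.const 4)).to_comp,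
    hF.comp (((computable_rat_num.comp Computable.fst).pair
      (computable_rat_den.comp Computable.fst)).pair Computable.snd), ?_⟩
  intro y hy q n hq
  set Y : ℕ := 7 * q.num.toNat * 7 ^ (n + 1) / q.den with hYdef
  have h7 : 7 ^ (n + 1) - 1 + 1 = 7 ^ (n + 1) :=
    Nat.sub_add_cancel (Nat.one_le_pow _ _ (by norm_num))
  have hDpos : (0 : ℝ) < 7 ^ (n + 1) := by positivity
  have hb := abs_digitPoint_sub_prefixVal_le hx (n + 1)
  have hC : prefixVal x (n + 1) ≤ 7 ^ (n + 1) := by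
    have h1 := hb.1.trans (digitPoint_mem_Icc hx).2
    rw [div_le_one hDpos] at h1
    exact_mod_cast h1
  have hG := cast_threeTentNat_div (Y := Y) (pow_pos (by norm_num : 0 < 7) (n + 1)) hC
  have hFq : ((F ((q.num.toNat, q.den), n) : ℚ) : ℝ) =
      threeTent ((prefixVal x (n + 1) : ℝ) / 7 ^ (n + 1)) ((Y : ℝ) / 7 ^ (n + 1) / 7) := by
    push_cast at hG
    rw [← hG]
    simp only [F, G, h7, ← hYdef]
    push_cast
    rfl
  rw [hFq]
  refine (abs_threeTent_sub_le _ _ _ _).trans ?_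
  have hpow : (1 : ℝ) / 7 ^ (n + 1) ≤ 1 / 7 * (1 / 2 ^ n) := by
    rw [pow_succ, ← one_div_mul_one_div, mul_comm (1 / 7 : ℝ)]
    gcongr
    norm_num
  have h2pos : (0 : ℝ) < 1 / 2 ^ n := by positivity
  refine max_le ?_ ?_
  · have hq0 : |y - max (q : ℝ) 0| ≤ 1 / 2 ^ (n + 4) := by
      refine le_trans ?_ hq
      have := abs_max_sub_max_le_abs y (q : ℝ) 0
      rwa [max_eq_left hy.1] at this
    have hd : 0 < q.den := q.pos
    have hd' : (0 : ℝ) < q.den := by exact_mod_cast hd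
    have hYq : |7 * max (q : ℝ) 0 - (Y : ℝ) / 7 ^ (n + 1)| ≤ 1 / 7 ^ (n + 1) := by
      rw [cast_rat_max_zero]
      have h1 : (Y : ℝ) ≤ ((7 * q.num.toNat * 7 ^ (n + 1) : ℕ) : ℝ) / q.den :=
        Nat.cast_div_le
      have h2 : ((7 * q.num.toNat * 7 ^ (n + 1) : ℕ) : ℝ) / q.den < (Y : ℝ) + 1 := by
        rw [div_lt_iff₀ hd']
        exact_mod_cast (Nat.div_lt_iff_lt_mul hd).1 (Nat.lt_succ_self Y)
      push_cast at h1 h2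
      have h3 : 7 * ((q.num.toNat : ℝ) / q.den) - (Y : ℝ) / 7 ^ (n + 1) =
          (7 * q.num.toNat * 7 ^ (n + 1) / q.den - Y) / 7 ^ (n + 1) := by
        field_simp
      rw [h3, abs_div, abs_of_pos hDpos]
      gcongr
      rw [abs_le]
      constructor <;> linarith
    have h16 : (1 : ℝ) / 2 ^ (n + 4) = 1 / 16 * (1 / 2 ^ n) := by
      rw [pow_add]; norm_num
    rw [abs_le] at *
    rw [h16] at hq0
    have h7a : 7 * |y - (Y : ℝ) / 7 ^ (n + 1) / 7| =
        |7 * y - (Y : ℝ) / 7 ^ (n + 1)| := by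
      rw [← abs_of_pos (by norm_num : (0 : ℝ) < 7), ← abs_mul,
        abs_of_pos (by norm_num : (0 : ℝ) < 7)]
      congr 1; ring
    rw [h7a, abs_le]
    constructor <;> linarith [hq0.1, hq0.2, hYq.1, hYq.2]
  · rw [add_div] at hb
    rw [abs_le]
    constructor <;> linarith [hb.1, hb.2]

/-- The point of the orbit of `digitPoint (blockSeq K)` at time `n`. -/
noncomputable def blockPoint (K : ℕ → ℕ) (n : ℕ) : ℝ := digitPoint fun t => blockSeq K (t + n)

theorem threeTent_iterate_blockPoint (c : ℝ) (K : ℕ → ℕ) (n : ℕ) :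
    (threeTent c)^[n] (digitPoint (blockSeq K)) = blockPoint K n :=
  threeTent_iterate_digitPoint c (blockSeq_lt K) n

theorem abs_blockPoint_sub_perPoint_lt {K : ℕ → ℕ} {m s L : ℕ} (h : s + L ≤ 2 * m) :
    |blockPoint K (m * m + 1 + s) - perPoint (K m) (m * m + 1 + s)| < 1 / 7 ^ L := by
  refine abs_digitPoint_sub_le (fun t => blockSeq_lt _ _) (fun t => perSeq_lt _ _) fun t ht => ?_
  rw [show t + (m * m + 1 + s) = m * m + 1 + (s + t) by ring, blockSeq_of_lt (by omega)]

theorem exists_abs_blockPoint_sub_perPoint_lt {K : ℕ → ℕ} {j : ℕ} (h : ∃ᶠ m in atTop, K m = j)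
    (i N : ℕ) {ε : ℝ} (hε : 0 < ε) : ∃ n ≥ N, |blockPoint K n - perPoint j i| < ε := by
  obtain ⟨L, hL⟩ := exists_seven_pow_lt hε
  obtain ⟨m, hm, rfl⟩ := frequently_atTop.1 h (N + L + j + 1)
  set j := K m
  set s := (i + j * (m * m + 1)) % (j + 1) with hs
  have hsj : s < j + 1 := Nat.mod_lt _ (by omega)
  have hmod : (m * m + 1 + s) % (j + 1) = i % (j + 1) := by
    rw [hs, Nat.add_mod_mod, show m * m + 1 + (i + j * (m * m + 1)) =
      i + (j + 1) * (m * m + 1) by ring, Nat.add_mul_mod_self_left]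
  refine ⟨m * m + 1 + s, by nlinarith, ?_⟩
  rw [← perPoint_mod j i, ← hmod, perPoint_mod]
  exact (abs_blockPoint_sub_perPoint_lt (by omega)).trans hL

theorem exists_blockPoint_dist_lt {S : Set ℕ} {K : ℕ → ℕ}
    (hK : ∀ j, Avoids S (ternaryDigit j) → ∃ᶠ m in atTop, K m = j) {y : ℝ}
    (hy : y ∈ attractorOf S) (N : ℕ) {ε : ℝ} (hε : 0 < ε) :
    ∃ n ≥ N, dist (blockPoint K n) y < ε := by
  obtain ⟨_, ⟨j, i, hj, rfl⟩, hz⟩ := Metric.mem_closure_iff.1 hy (ε / 2) (half_pos hε)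
  obtain ⟨n, hn, h⟩ := exists_abs_blockPoint_sub_perPoint_lt (hK j hj) i N (half_pos hε)
  refine ⟨n, hn, ?_⟩
  rw [dist_comm] at hz
  rw [← Real.dist_eq] at h
  linarith [dist_triangle (blockPoint K n) (perPoint j i) y]

theorem attractorOf_subset_omegaSet {S : Set ℕ} {K : ℕ → ℕ}
    (hK : ∀ j, Avoids S (ternaryDigit j) → ∃ᶠ m in atTop, K m = j) (c : ℝ) :
    attractorOf S ⊆ omegaSet (threeTent c) (digitPoint (blockSeq K)) := by
  intro y hy
  refine mapClusterPt_iff_frequently.2 fun U hU => ?_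
  obtain ⟨ε, hε, hεU⟩ := Metric.mem_nhds_iff.1 hU
  refine frequently_atTop.2 fun N => ?_
  obtain ⟨n, hn, h⟩ := exists_blockPoint_dist_lt hK hy N hε
  exact ⟨n, hn, hεU (by rwa [threeTent_iterate_blockPoint])⟩

theorem avoids_ternaryDigit_zero (S : Set ℕ) : Avoids S (ternaryDigit 0) := by
  intro i e _ hm
  have := hm.1
  simp [ternaryDigit] at this

theorem goodAt_stageSelector (m : ℕ) : GoodAt m (stageSelector m) := by
  unfold stageSelector
  split_ifs with h
  · exact h
  · exact goodAt_iff.2 (avoids_ternaryDigit_zero _)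

theorem frequently_stageSelector_eq {j : ℕ} (h : Avoids HaltSet (ternaryDigit j)) :
    ∃ᶠ m in atTop, stageSelector m = j :=
  (frequently_ruler_eq j).mono fun m hm => by
    rw [stageSelector, hm, if_pos (GoodAt.of_avoids h)]

/-- The value of the map to the right of the tents. -/
noncomputable def criticalValue : ℝ := digitPoint (blockSeq stageSelector)

theorem criticalValue_mem_Icc : criticalValue ∈ Icc (0 : ℝ) 1 := digitPoint_mem_Icc (blockSeq_lt _)

/-- The computable interval map. -/
noncomputable def attractorMap : ℝ → ℝ := threeTent criticalValue

theorem computableRealMap_attractorMap : ComputableRealMap attractorMap :=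
  computableRealMap_threeTent (Primrec.blockSeq primrec_stageSelector) (blockSeq_lt _)

theorem attractorMap_iterate_criticalValue (n : ℕ) :
    attractorMap^[n] criticalValue = blockPoint stageSelector n :=
  threeTent_iterate_blockPoint _ _ n

theorem omegaSet_criticalValue_subset :
    omegaSet attractorMap criticalValue ⊆ attractorOf HaltSet := by
  intro y hy
  by_contra hyA
  obtain ⟨ε, hε, hεA⟩ := Metric.isOpen_iff.1 (isClosed_attractorOf HaltSet).isOpen_compl y hyA
  have hempty : Icc (y - ε / 2) (y + ε / 2) ∩ attractorOf HaltSet = ∅ := by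
    rw [Set.eq_empty_iff_forall_notMem]
    rintro z ⟨hz, hzA⟩
    refine hεA ?_ hzA
    rw [Metric.mem_ball, Real.dist_eq, abs_lt]
    constructor <;> linarith [hz.1, hz.2]
  obtain ⟨N, M, h⟩ := (Icc_inter_attractorOf_eq_empty_iff (by linarith)).1 hempty
  have hfreq := mapClusterPt_iff_frequently.1 hy _
    (Icc_mem_nhds (by linarith : y - ε / 2 < y) (by linarith : y < y + ε / 2))
  obtain ⟨n, hn, hnI⟩ := frequently_atTop.1 hfreq (M * M)
  rw [attractorMap_iterate_criticalValue] at hnI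
  have hav : Avoids (haltedBy M) fun t => blockSeq stageSelector (t + n) := by
    refine Avoids.blockSeq fun m hm => ?_
    have hMm : M ≤ m := (Nat.le_sqrt.2 hn).trans hm
    exact (goodAt_iff.1 (goodAt_stageSelector m)).mono (haltedBy_mono hMm)
  have hlt : ∀ t, blockSeq stageSelector (t + n) < 3 := fun t => blockSeq_lt _ _
  obtain ⟨j, hj, hja, hjd⟩ := exists_avoids_truncation hlt hav N
  have hb := abs_digitPoint_sub_prefixVal_le hlt N
  rw [prefixVal_congr fun t ht => (hjd t ht).symm] at hb
  rcases h j hj (goodAt_iff.2 hja) with h3 | h3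
  · exact absurd hnI.2 (not_le.2 (h3.trans_le hb.1))
  · exact absurd hnI.1 (not_le.2 (hb.2.trans h3))

theorem omegaSet_criticalValue : omegaSet attractorMap criticalValue = attractorOf HaltSet :=
  omegaSet_criticalValue_subset.antisymm
    (attractorOf_subset_omegaSet (fun _ hj => frequently_stageSelector_eq hj) _)

open Classical in
/-- The index `j` if its word avoids all `2 1ᵉ 2` with `e ∈ HaltSet`, and `0` otherwise. -/
noncomputable def goodIndex (j : ℕ) : ℕ := if Avoids HaltSet (ternaryDigit j) then j else 0

theorem avoids_goodIndex (j : ℕ) : Avoids HaltSet (ternaryDigit (goodIndex j)) := by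
  unfold goodIndex
  split_ifs with h
  · exact h
  · exact avoids_ternaryDigit_zero _

theorem goodIndex_of_avoids {j : ℕ} (h : Avoids HaltSet (ternaryDigit j)) : goodIndex j = j :=
  if_pos h

theorem exists_dense_orbit :
    ∃ x ∈ attractorOf HaltSet,
      attractorOf HaltSet ⊆ closure (range fun n : ℕ => attractorMap^[n] x) := by
  refine ⟨digitPoint (blockSeq (goodIndex ∘ ruler)), digitPoint_mem_attractorOf (blockSeq_lt _)
    (Avoids.blockSeq (n := 0) fun m _ => avoids_goodIndex _), fun y hy => ?_⟩
  refine Metric.mem_closure_iff.2 fun ε hε => ?_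
  have hK : ∀ j, Avoids HaltSet (ternaryDigit j) →
      ∃ᶠ m in atTop, (goodIndex ∘ ruler) m = j := fun j hj =>
    (frequently_ruler_eq j).mono fun m hm => by
      rw [Function.comp_apply, hm, goodIndex_of_avoids hj]
  obtain ⟨n, -, h⟩ := exists_blockPoint_dist_lt hK hy 0 hε
  refine ⟨_, ⟨n, rfl⟩, ?_⟩
  rw [dist_comm]
  simpa only [attractorMap, threeTent_iterate_blockPoint] using h

theorem omegaSet_eq_of_iterate_eq {X : Type*} [TopologicalSpace X] {T : X → X} {x y : X} {k : ℕ}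
    (h : T^[k] x = y) : omegaSet T x = omegaSet T y := by
  have : map (fun n => T^[n] y) atTop = map (fun n => T^[n] x) atTop := by
    conv_rhs => rw [← map_add_atTop_eq_nat k, map_map]
    congr 1
    funext n
    rw [Function.comp_apply, Function.iterate_add_apply, h]
  ext z
  simp only [omegaSet, mem_ofPred_eq, MapClusterPt, this]

theorem ae_omegaSet_eq :
    ∀ᵐ x ∂(volume.restrict (Icc (0 : ℝ) 1)), omegaSet attractorMap x = attractorOf HaltSet := by
  filter_upwards [ae_exists_iterate_eq criticalValue_mem_Icc] with x hx
  obtain ⟨k, hk⟩ := hx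
  rw [← omegaSet_criticalValue]
  exact omegaSet_eq_of_iterate_eq hk

theorem isMetricAttractor_attractorMap :
    IsMetricAttractor attractorMap (volume.restrict (Icc (0 : ℝ) 1)) (attractorOf HaltSet) := by
  refine ⟨isClosed_attractorOf _, mapsTo_attractorOf _ _, ?_, fun A' _ hA' => ?_⟩
  · have h : realm attractorMap (attractorOf HaltSet) =ᵐ[volume.restrict (Icc (0 : ℝ) 1)] univ := by
      rw [eventuallyEq_univ]
      filter_upwards [ae_omegaSet_eq] with x hx
      exact hx.le
    rw [measure_congr h]
    simp
  · rw [measure_eq_zero_iff_ae_notMem]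
    filter_upwards [ae_omegaSet_eq] with x hx hxA
    exact hA'.not_subset (hx ▸ hxA)

/-- The uniform measure on the periodic orbit of `perPoint k 0`. -/
noncomputable def perMeasure (k : ℕ) : Measure ℝ :=
  ((k + 1 : ℕ) : ℝ≥0∞)⁻¹ • ∑ i ∈ Finset.range (k + 1), Measure.dirac (perPoint k i)

/-- The physical measure: the average of the good periodic orbits with weights `2^{-(j+1)}`. -/
noncomputable def physMeasure : Measure ℝ :=
  Measure.sum fun j => ((2 : ℝ≥0∞)⁻¹ ^ (j + 1)) • perMeasure (goodIndex j)

/-- The average of `φ` over the periodic orbit of `perPoint k 0`. -/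
noncomputable def orbitAvg (φ : ℝ → ℝ) (k : ℕ) : ℝ :=
  (∑ i ∈ Finset.range (k + 1), φ (perPoint k i)) / (k + 1 : ℕ)

theorem perMeasure_eq_one {k : ℕ} {U : Set ℝ} (hU : MeasurableSet U)
    (h : ∀ i, perPoint k i ∈ U) : perMeasure k U = 1 := by
  have h1 : (((k + 1 : ℕ) : ℝ≥0∞)) ≠ 0 := by exact_mod_cast Nat.succ_ne_zero k
  simp only [perMeasure, Measure.smul_apply, Measure.finsetSum_apply, smul_eq_mul,
    Measure.dirac_apply' _ hU, indicator_of_mem (h _), Pi.one_apply, Finset.sum_const,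
    Finset.card_range, nsmul_eq_mul, mul_one]
  exact ENNReal.inv_mul_cancel h1 (ENNReal.natCast_ne_top _)

theorem map_perMeasure (k : ℕ) : Measure.map attractorMap (perMeasure k) = perMeasure k := by
  have hm : Measurable attractorMap := (continuous_threeTent _).measurable
  have hd : ∀ i, Measure.map attractorMap (Measure.dirac (perPoint k i)) =
      Measure.dirac (perPoint k (i + 1)) := fun i => by
    rw [Measure.map_dirac' hm, attractorMap, threeTent_perPoint]
  rw [perMeasure, Measure.map_smul, Measure.map_finset_sum hm.aemeasurable]
  congr 1
  simp only [hd]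
  rw [Finset.sum_range_succ, Finset.sum_range_succ' _ k]
  congr 2
  simpa using perPoint_add_period k 0

theorem tsum_half_pow : ∑' j : ℕ, (2 : ℝ≥0∞)⁻¹ ^ (j + 1) = 1 := by
  rw [ENNReal.tsum_geometric_add_one, ENNReal.one_sub_inv_two, inv_inv]
  exact ENNReal.inv_mul_cancel (by norm_num) (by norm_num)

theorem physMeasure_attractor : physMeasure (attractorOf HaltSet) = 1 := by
  have hA := (isClosed_attractorOf HaltSet).measurableSet
  rw [physMeasure, Measure.sum_apply _ hA]
  simp only [Measure.smul_apply, smul_eq_mul]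
  rw [← tsum_half_pow]
  refine tsum_congr fun j => ?_
  rw [perMeasure_eq_one hA fun i => perPoint_mem_attractorOf (avoids_goodIndex j) i, mul_one]

instance isProbabilityMeasure_perMeasure (k : ℕ) : IsProbabilityMeasure (perMeasure k) :=
  ⟨perMeasure_eq_one .univ fun _ => trivial⟩

instance isProbabilityMeasure_physMeasure : IsProbabilityMeasure physMeasure := by
  refine ⟨?_⟩
  rw [physMeasure, Measure.sum_apply _ .univ]
  simpa using tsum_half_pow

theorem map_physMeasure : Measure.map attractorMap physMeasure = physMeasure := by
  have hm : Measurable attractorMap := (continuous_threeTent _).measurable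
  rw [physMeasure, Measure.map_sum hm.aemeasurable]
  simp only [Measure.map_smul, map_perMeasure]

theorem ae_mem_attractor : ∀ᵐ x ∂physMeasure, x ∈ attractorOf HaltSet := by
  have h := (prob_compl_eq_zero_iff (isClosed_attractorOf HaltSet).measurableSet).2
    physMeasure_attractor
  exact h

theorem perMeasure_pos {k i : ℕ} {U : Set ℝ} (hU : MeasurableSet U) (h : perPoint k i ∈ U) :
    0 < perMeasure k U := by
  simp only [perMeasure, Measure.smul_apply, Measure.finsetSum_apply, smul_eq_mul]
  refine ENNReal.mul_pos (ENNReal.inv_ne_zero.2 (ENNReal.natCast_ne_top _)) fun h0 => ?_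
  have := (Finset.sum_eq_zero_iff.1 h0) (i % (k + 1))
    (Finset.mem_range.2 (Nat.mod_lt _ (by omega)))
  rw [perPoint_mod, Measure.dirac_apply' _ hU, indicator_of_mem h] at this
  exact one_ne_zero this

theorem physMeasure_pos_of_isOpen {U : Set ℝ} (hU : IsOpen U)
    (h : (U ∩ attractorOf HaltSet).Nonempty) : 0 < physMeasure U := by
  obtain ⟨y, hyU, hyA⟩ := h
  obtain ⟨_, hz, j, i, hj, rfl⟩ := mem_closure_iff.1 hyA U hU hyU
  rw [physMeasure, Measure.sum_apply _ hU.measurableSet]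
  refine lt_of_lt_of_le ?_ (ENNReal.le_tsum j)
  rw [goodIndex_of_avoids hj, Measure.smul_apply, smul_eq_mul]
  exact ENNReal.mul_pos (pow_ne_zero _ (by norm_num)) (perMeasure_pos hU.measurableSet hz).ne'

theorem measSupport_physMeasure : measSupport physMeasure = attractorOf HaltSet := by
  ext y
  constructor
  · intro hy
    by_contra hyA
    have := hy _ (isClosed_attractorOf HaltSet).isOpen_compl hyA
    rw [(prob_compl_eq_zero_iff (isClosed_attractorOf HaltSet).measurableSet).2
      physMeasure_attractor] at this
    exact lt_irrefl _ this
  · exact fun hy U hU hyU => physMeasure_pos_of_isOpen hU ⟨y, hyU, hy⟩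

theorem integral_perMeasure {φ : ℝ → ℝ} (hφ : Continuous φ) (k : ℕ) :
    ∫ x, φ x ∂(perMeasure k) = orbitAvg φ k := by
  rw [perMeasure, integral_smul_measure, integral_finsetSum_measure
    fun i _ => integrable_dirac' hφ.stronglyMeasurable (by simp)]
  simp only [integral_dirac' _ _ hφ.stronglyMeasurable]
  rw [orbitAvg, ENNReal.toReal_inv, ENNReal.toReal_natCast, smul_eq_mul, inv_mul_eq_div]

theorem hasSum_integral_physMeasure {φ : ℝ → ℝ} (hφ : Continuous φ) :
    HasSum (fun j => orbitAvg φ (goodIndex j) / 2 ^ (j + 1)) (∫ x, φ x ∂physMeasure) := by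
  obtain ⟨B, hB⟩ := isCompact_Icc.exists_bound_of_continuousOn
    (hφ.continuousOn (s := Icc (0 : ℝ) 1))
  have hφi : Integrable φ physMeasure :=
    Integrable.of_bound hφ.aestronglyMeasurable B
      (ae_mem_attractor.mono fun x hx => hB x (attractorOf_subset _ hx))
  have h := hasSum_integral_measure hφi
  refine h.congr_fun ?_
  intro j
  rw [integral_smul_measure, integral_perMeasure hφ, ENNReal.toReal_pow, ENNReal.toReal_inv]
  simp [div_eq_inv_mul]

theorem sum_range_periodic {g : ℕ → ℝ} {p : ℕ} (hg : ∀ n, g (n + p) = g n) (n : ℕ) :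
    ∑ s ∈ Finset.range p, g (n + s) = ∑ s ∈ Finset.range p, g s := by
  induction n with
  | zero => simp
  | succ n ih =>
    rw [← ih]
    have h1 := Finset.sum_range_succ (fun s => g (n + s)) p
    have h2 := Finset.sum_range_succ' (fun s => g (n + s)) p
    simp only [hg, add_zero] at h1 h2
    rw [h1] at h2
    rw [add_right_cancel h2]
    exact Finset.sum_congr rfl fun s _ => by rw [show n + 1 + s = n + (s + 1) by ring]

theorem abs_sum_window_sub_le {g : ℕ → ℝ} {p : ℕ} {B : ℝ} (hp : 0 < p)
    (hg : ∀ n, g (n + p) = g n) (hB : ∀ n, |g n| ≤ B) (n T : ℕ) :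
    |∑ s ∈ Finset.range T, g (n + s) - T * ((∑ s ∈ Finset.range p, g s) / p)| ≤ 2 * B * p := by
  have hp' : (0 : ℝ) < p := by exact_mod_cast hp
  have hB0 : 0 ≤ B := (abs_nonneg _).trans (hB 0)
  have havg : |(∑ s ∈ Finset.range p, g s) / p| ≤ B := by
    rw [abs_div, abs_of_pos hp', div_le_iff₀ hp']
    refine (Finset.abs_sum_le_sum_abs _ _).trans ((Finset.sum_le_sum fun s _ => hB s).trans ?_)
    simp [mul_comm]
  induction T using Nat.strong_induction_on generalizing n with
  | _ T ih =>
    rcases lt_or_ge T p with hT | hT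
    · have hT' : (T : ℝ) ≤ p := by exact_mod_cast hT.le
      have h1 : |∑ s ∈ Finset.range T, g (n + s)| ≤ T * B := by
        refine (Finset.abs_sum_le_sum_abs _ _).trans
          ((Finset.sum_le_sum fun s _ => hB (n + s)).trans ?_)
        simp
      have h2 : |T * ((∑ s ∈ Finset.range p, g s) / p)| ≤ T * B := by
        rw [abs_mul, Nat.abs_cast]
        exact mul_le_mul_of_nonneg_left havg (Nat.cast_nonneg _)
      refine (abs_sub _ _).trans ?_
      nlinarith
    · obtain ⟨T, rfl⟩ := Nat.exists_eq_add_of_le hT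
      have h := ih T (by omega) (n + p)
      rw [Finset.sum_range_add, sum_range_periodic hg]
      convert h using 2
      push_cast
      field_simp
      simp only [add_assoc]
      ring

theorem sum_range_ruler_two_mul (α : ℕ → ℝ) (N : ℕ) :
    ∑ m ∈ Finset.range (2 * N), α (ruler m) =
      N * α 0 + ∑ m ∈ Finset.range N, α (ruler m + 1) := by
  induction N with
  | zero => simp
  | succ N ih =>
    rw [show 2 * (N + 1) = 2 * N + 1 + 1 by ring, Finset.sum_range_succ, Finset.sum_range_succ, ih,
      ruler_two_mul, ruler_two_mul_add_one, Finset.sum_range_succ]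
    push_cast
    ring

theorem abs_sum_ruler_sub_le {B : ℝ} (M : ℕ) {α : ℕ → ℝ} {l : ℝ} (hα : ∀ j, |α j| ≤ B)
    (hl : HasSum (fun j => α j / 2 ^ (j + 1)) l) :
    |∑ m ∈ Finset.range M, α (ruler m) - M * l| ≤ 2 * B * (Nat.log 2 M + 1) := by
  have hB0 : 0 ≤ B := (abs_nonneg _).trans (hα 0)
  induction M using Nat.strong_induction_on generalizing α l with
  | _ M ih =>
    rcases Nat.eq_zero_or_pos M with rfl | hM
    · simp
      positivity
    have hgeo : HasSum (fun j : ℕ => B / 2 ^ (j + 1)) B := by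
      refine (hasSum_geometric_two' B).congr_fun fun j => ?_
      rw [pow_succ]
      field_simp
    have hlB : |l| ≤ B := by
      refine abs_le.2 ⟨?_, ?_⟩
      · refine hasSum_le (fun j => ?_) hgeo.neg hl
        rw [← neg_div]
        gcongr
        exact (abs_le.1 (hα j)).1
      · refine hasSum_le (fun j => ?_) hl hgeo
        gcongr
        exact (abs_le.1 (hα j)).2
    have hl' : HasSum (fun j => α (j + 1) / 2 ^ (j + 1)) (2 * l - α 0) := by
      have h1 := ((hasSum_nat_add_iff' 1).2 hl).mul_left 2
      simp only [Finset.range_one, Finset.sum_singleton] at h1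
      rw [show 2 * l - α 0 = 2 * (l - α 0 / 2 ^ (0 + 1)) by ring]
      refine h1.congr_fun fun j => ?_
      rw [pow_succ 2 (j + 1)]
      field_simp
    obtain ⟨N, hN | hN⟩ := Nat.even_or_odd' M
    · have h := ih N (by omega) (fun j => hα (j + 1)) hl'
      have hlog : (Nat.log 2 N : ℝ) ≤ Nat.log 2 M := by
        exact_mod_cast Nat.log_mono_right (by omega)
      rw [hN, sum_range_ruler_two_mul, ← hN]
      have : (M : ℝ) = 2 * N := by exact_mod_cast hN
      rw [this]
      rw [show N * α 0 + ∑ m ∈ Finset.range N, α (ruler m + 1) - 2 * N * l =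
        ∑ m ∈ Finset.range N, α (ruler m + 1) - N * (2 * l - α 0) by ring]
      refine h.trans ?_
      gcongr
    · rw [hN, Finset.sum_range_succ, sum_range_ruler_two_mul, ruler_two_mul]
      push_cast
      rcases Nat.eq_zero_or_pos N with rfl | hN0
      · have h0 := abs_sub (α 0) l
        have := hα 0
        simp
        linarith
      have h := ih N (by omega) (fun j => hα (j + 1)) hl'
      have hlog : Nat.log 2 N + 1 = Nat.log 2 (2 * N + 1) := by
        rw [Nat.log_of_one_lt_of_le (n := 2 * N + 1) (by norm_num) (by omega)]
        congr 2
        omega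
      have hlog' : (Nat.log 2 (2 * N + 1) : ℝ) = Nat.log 2 N + 1 := by exact_mod_cast hlog.symm
      rw [hlog', show N * α 0 + ∑ m ∈ Finset.range N, α (ruler m + 1) + α 0 - (2 * N + 1) * l =
        (∑ m ∈ Finset.range N, α (ruler m + 1) - N * (2 * l - α 0)) + (α 0 - l) by ring]
      have h1 := abs_sub (α 0) l
      have h2 := hα 0
      refine (abs_add_le _ _).trans ?_
      linarith

theorem sq_succ_le_four_mul_two_pow (r : ℕ) : (r + 1) ^ 2 ≤ 4 * 2 ^ r := by
  induction r with
  | zero => norm_num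
  | succ r ih =>
    rcases r with _ | _ | r
    · norm_num
    · norm_num
    · calc (r + 1 + 1 + 1 + 1) ^ 2 ≤ (r + 1 + 1 + 1) ^ 2 * 2 := by
            nlinarith [Nat.zero_le (r * r), Nat.zero_le r]
        _ ≤ 4 * 2 ^ (r + 1 + 1) * 2 := Nat.mul_le_mul_right 2 ih
        _ = 4 * 2 ^ (r + 1 + 1 + 1) := by ring

theorem isLittleO_of_two_pow_le {u : ℕ → ℕ} (h : ∀ m, 2 ^ u m ≤ m + 1) :
    (fun m => (u m : ℝ) + 1) =o[atTop] fun m : ℕ => (2 * m + 1 : ℝ) := by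
  refine Asymptotics.IsLittleO.of_bound fun c hc => ?_
  have ht : Tendsto (fun m : ℕ => c ^ 2 * (m + 1 : ℝ)) atTop atTop :=
    (tendsto_atTop_add_const_right _ _ tendsto_natCast_atTop_atTop).const_mul_atTop (by positivity)
  filter_upwards [ht.eventually_ge_atTop 4] with m hm
  have h1 : (u m + 1) ^ 2 ≤ 4 * (m + 1) :=
    (sq_succ_le_four_mul_two_pow _).trans (Nat.mul_le_mul_left 4 (h m))
  have h2 : ((u m : ℝ) + 1) ^ 2 ≤ 4 * (m + 1) := by exact_mod_cast h1
  rw [Real.norm_of_nonneg (by positivity), Real.norm_of_nonneg (by positivity)]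
  refine (abs_le_of_sq_le_sq' (?_ : _ ≤ (c * (m + 1 : ℝ)) ^ 2) (by positivity)).2.trans ?_
  · refine h2.trans ?_
    rw [mul_pow, sq (m + 1 : ℝ), ← mul_assoc]
    exact mul_le_mul_of_nonneg_right hm (by positivity)
  · gcongr
    have : (0 : ℝ) ≤ m := Nat.cast_nonneg m
    linarith

theorem two_pow_dvd_of_le_ruler {k m : ℕ} (h : k ≤ ruler m) : 2 ^ k ∣ m + 1 :=
  (pow_dvd_pow 2 h).trans
    (Nat.findGreatest_spec (P := fun k => 2 ^ k ∣ m + 1) (Nat.zero_le m) (by simp))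

theorem stageSelector_le_ruler (m : ℕ) : stageSelector m ≤ ruler m := by
  unfold stageSelector
  split_ifs
  · exact le_rfl
  · exact Nat.zero_le _

theorem eventually_stageSelector_eq (k : ℕ) :
    ∀ᶠ m in atTop, ruler m < k → stageSelector m = goodIndex (ruler m) := by
  filter_upwards [eventually_forall_goodAt_iff k] with m hm hr
  simp only [stageSelector, goodIndex]
  congr 1
  exact propext (hm _ hr)

theorem isLittleO_ruler_add_one :
    (fun m => (ruler m : ℝ) + 1) =o[atTop] fun m : ℕ => (2 * m + 1 : ℝ) :=
  isLittleO_of_two_pow_le two_pow_ruler_le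

theorem isLittleO_sum_ruler_sub {B l : ℝ} {α : ℕ → ℝ} (hα : ∀ j, |α j| ≤ B)
    (hl : HasSum (fun j => α j / 2 ^ (j + 1)) l) :
    (fun M => ∑ m ∈ Finset.range M, (α (ruler m) - l)) =o[atTop]
      fun M : ℕ => (2 * M + 1 : ℝ) := by
  have hlog : ∀ m, 2 ^ Nat.log 2 m ≤ m + 1 := fun m => by
    rcases Nat.eq_zero_or_pos m with rfl | hm
    · simp
    · exact (Nat.pow_log_le_self 2 hm.ne').trans (Nat.le_succ m)
  refine Asymptotics.IsBigO.trans_isLittleO (Asymptotics.IsBigO.of_bound (2 * B) ?_)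
    (isLittleO_of_two_pow_le hlog)
  refine Eventually.of_forall fun M => ?_
  rw [Finset.sum_sub_distrib, Finset.sum_const, Finset.card_range, nsmul_eq_mul,
    Real.norm_of_nonneg (by positivity : (0 : ℝ) ≤ (Nat.log 2 M : ℝ) + 1)]
  exact abs_sum_ruler_sub_le M hα hl

theorem isLittleO_sum_of_eventually_zero {B : ℝ} {d : ℕ → ℝ} (hd : ∀ m, |d m| ≤ B)
    (h : ∀ k, ∀ᶠ m in atTop, ruler m < k → d m = 0) :
    (fun M => ∑ m ∈ Finset.range M, d m) =o[atTop] fun M : ℕ => (2 * M + 1 : ℝ) := by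
  have hB0 : 0 ≤ B := (abs_nonneg _).trans (hd 0)
  refine Asymptotics.IsLittleO.of_bound fun c hc => ?_
  obtain ⟨k, hk⟩ := exists_pow_lt_of_lt_one (y := (1 / 2 : ℝ)) (x := c / (B + 1)) (by positivity)
    (by norm_num)
  obtain ⟨m₀, hm₀⟩ := eventually_atTop.1 (h k)
  have ht : Tendsto (fun M : ℕ => c * (M : ℝ)) atTop atTop :=
    tendsto_natCast_atTop_atTop.const_mul_atTop hc
  filter_upwards [ht.eventually_ge_atTop (m₀ * B)] with M hM
  have hpt : ∀ m, |d m| ≤ (if m < m₀ then B else 0) + if 2 ^ k ∣ m + 1 then B else 0 := by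
    intro m
    split_ifs with h1 h2 h2
    · linarith [hd m]
    · linarith [hd m]
    · linarith [hd m]
    · rw [hm₀ m (not_lt.1 h1) (not_le.1 fun hr => h2 (two_pow_dvd_of_le_ruler hr))]
      simp
  have h1 : ∑ m ∈ Finset.range M, (if m < m₀ then B else 0) ≤ m₀ * B := by
    rw [← Finset.sum_filter, Finset.sum_const, nsmul_eq_mul]
    refine mul_le_mul_of_nonneg_right ?_ hB0
    have : (Finset.range M).filter (· < m₀) ⊆ Finset.range m₀ := fun m hm => by
      simp only [Finset.mem_filter] at hm
      exact Finset.mem_range.2 hm.2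
    exact_mod_cast (Finset.card_le_card this).trans_eq (Finset.card_range m₀)
  have h2 : ∑ m ∈ Finset.range M, (if 2 ^ k ∣ m + 1 then B else 0) ≤ c * M := by
    rw [← Finset.sum_filter, Finset.sum_const, nsmul_eq_mul, Nat.card_multiples]
    have h3 : ((M / 2 ^ k : ℕ) : ℝ) ≤ M * (1 / 2) ^ k := by
      refine Nat.cast_div_le.trans_eq ?_
      push_cast
      rw [div_pow, one_pow, mul_one_div]
    have h4 : (1 / 2 : ℝ) ^ k * B ≤ c := by
      rw [lt_div_iff₀ (by positivity)] at hk
      nlinarith [pow_pos (by norm_num : (0 : ℝ) < 1 / 2) k]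
    calc ((M / 2 ^ k : ℕ) : ℝ) * B ≤ M * (1 / 2) ^ k * B := mul_le_mul_of_nonneg_right h3 hB0
      _ = M * ((1 / 2) ^ k * B) := by ring
      _ ≤ M * c := mul_le_mul_of_nonneg_left h4 (Nat.cast_nonneg _)
      _ = c * M := mul_comm _ _
  have h3 := (Finset.abs_sum_le_sum_abs d (Finset.range M)).trans
    (Finset.sum_le_sum fun m _ => hpt m)
  rw [Finset.sum_add_distrib] at h3
  rw [Real.norm_eq_abs, Real.norm_of_nonneg (by positivity)]
  linarith

theorem isLittleO_sum_stageSelector_sub {B l : ℝ} {a : ℕ → ℝ} (ha : ∀ j, |a j| ≤ B)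
    (hl : HasSum (fun j => a (goodIndex j) / 2 ^ (j + 1)) l) :
    (fun M => ∑ m ∈ Finset.range M, (a (stageSelector m) - l)) =o[atTop]
      fun M : ℕ => (2 * M + 1 : ℝ) := by
  have h1 := isLittleO_sum_ruler_sub (α := fun j => a (goodIndex j)) (fun j => ha _) hl
  have h2 := isLittleO_sum_of_eventually_zero (B := B + B)
    (d := fun m => a (stageSelector m) - a (goodIndex (ruler m)))
    (fun m => (abs_sub _ _).trans (add_le_add (ha _) (ha _)))
    (fun k => (eventually_stageSelector_eq k).mono fun m hm hr => by rw [hm hr, sub_self])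
  refine (h1.add h2).congr_left fun M => ?_
  rw [← Finset.sum_add_distrib]
  exact Finset.sum_congr rfl fun m _ => by ring

theorem sum_range_two_mul_add_one (M : ℕ) :
    ∑ m ∈ Finset.range M, (2 * m + 1 : ℝ) = (M : ℝ) ^ 2 := by
  induction M with
  | zero => simp
  | succ M ih =>
    rw [Finset.sum_range_succ, ih]
    push_cast
    ring

theorem Asymptotics.IsLittleO.sum_two_mul_add_one {u : ℕ → ℝ}
    (h : u =o[atTop] fun m : ℕ => (2 * m + 1 : ℝ)) :
    (fun M => ∑ m ∈ Finset.range M, u m) =o[atTop] fun M : ℕ => (M : ℝ) ^ 2 := by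
  have ht : Tendsto (fun M : ℕ => (M : ℝ) ^ 2) atTop atTop :=
    (tendsto_pow_atTop two_ne_zero).comp tendsto_natCast_atTop_atTop
  have := Asymptotics.IsLittleO.sum_range h (fun m => by positivity)
    (by simpa only [sum_range_two_mul_add_one] using ht)
  simpa only [sum_range_two_mul_add_one] using this

theorem sum_two_mul_add_one_mul (v : ℕ → ℝ) (M : ℕ) :
    ∑ m ∈ Finset.range M, (2 * m + 1 : ℝ) * v m =
      2 * M * ∑ m ∈ Finset.range M, v m -
        ∑ m ∈ Finset.range M, (2 * ∑ i ∈ Finset.range m, v i + v m) := by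
  induction M with
  | zero => simp
  | succ M ih =>
    rw [Finset.sum_range_succ, ih, Finset.sum_range_succ v, Finset.sum_range_succ _ M]
    push_cast
    ring

theorem isLittleO_sum_two_mul_add_one_mul {B : ℝ} {v : ℕ → ℝ} (hB : ∀ m, |v m| ≤ B)
    (h : (fun M => ∑ m ∈ Finset.range M, v m) =o[atTop] fun M : ℕ => (2 * M + 1 : ℝ)) :
    (fun M => ∑ m ∈ Finset.range M, (2 * m + 1 : ℝ) * v m) =o[atTop]
      fun M : ℕ => (M : ℝ) ^ 2 := by
  have ht : Tendsto (fun M : ℕ => (2 * M + 1 : ℝ)) atTop atTop :=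
    tendsto_atTop_add_const_right _ _ (tendsto_natCast_atTop_atTop.const_mul_atTop two_pos)
  have hv : v =o[atTop] fun M : ℕ => (2 * M + 1 : ℝ) := by
    refine Asymptotics.IsBigO.trans_isLittleO (g := fun _ => (1 : ℝ)) ?_
      ((Asymptotics.isLittleO_const_left_of_ne one_ne_zero).2
        (tendsto_norm_atTop_atTop.comp ht))
    exact Asymptotics.IsBigO.of_bound B (Eventually.of_forall fun m => by simpa using hB m)
  have h1 := ((h.const_mul_left 2).add hv).sum_two_mul_add_one
  have h2 : (fun M : ℕ => 2 * (M : ℝ) * ∑ m ∈ Finset.range M, v m) =o[atTop]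
      fun M : ℕ => (M : ℝ) ^ 2 := by
    have hO : (fun M : ℕ => (2 * M + 1 : ℝ)) =O[atTop] fun M : ℕ => (M : ℝ) := by
      refine Asymptotics.IsBigO.of_bound 3 ?_
      filter_upwards [eventually_ge_atTop 1] with M hM
      have : (1 : ℝ) ≤ M := by exact_mod_cast hM
      rw [Real.norm_of_nonneg (by positivity), Real.norm_of_nonneg (by positivity)]
      linarith
    have hM : (fun M : ℕ => 2 * (M : ℝ)) =O[atTop] fun M : ℕ => (M : ℝ) :=
      Asymptotics.isBigO_const_mul_self _ _ _
    exact (hM.mul_isLittleO (h.trans_isBigO hO)).congr_right fun M => (sq _).symm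
  exact (h2.sub h1).congr_left fun M => (sum_two_mul_add_one_mul v M).symm

theorem sum_range_sq (E : ℕ → ℝ) (M : ℕ) :
    ∑ n ∈ Finset.range (M ^ 2), E n =
      ∑ m ∈ Finset.range M, ∑ s ∈ Finset.range (2 * m + 1), E (m ^ 2 + s) := by
  induction M with
  | zero => simp
  | succ M ih =>
    rw [Finset.sum_range_succ, ← ih, ← Finset.sum_range_add]
    congr 2
    ring

theorem isLittleO_sum_of_sq {B : ℝ} {E : ℕ → ℝ} (hB : ∀ n, |E n| ≤ B)
    (h : (fun M => ∑ n ∈ Finset.range (M ^ 2), E n) =o[atTop] fun M : ℕ => (M : ℝ) ^ 2) :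
    (fun n => ∑ i ∈ Finset.range n, E i) =o[atTop] fun n : ℕ => (n : ℝ) := by
  have hsqrt : Tendsto Nat.sqrt atTop atTop :=
    tendsto_atTop.2 fun b => (eventually_ge_atTop (b * b)).mono fun n hn => Nat.le_sqrt.2 hn
  have hO : (fun n => (Nat.sqrt n : ℝ) ^ 2) =O[atTop] fun n : ℕ => (n : ℝ) := by
    refine Asymptotics.IsBigO.of_bound 1 (Eventually.of_forall fun n => ?_)
    rw [Real.norm_of_nonneg (by positivity), Real.norm_of_nonneg (by positivity), one_mul]
    exact_mod_cast Nat.sqrt_le' n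
  have ho : (fun n => (Nat.sqrt n : ℝ)) =o[atTop] fun n : ℕ => (n : ℝ) := by
    have : (fun M : ℕ => (M : ℝ)) =o[atTop] fun M : ℕ => (M : ℝ) ^ 2 := by
      have := (Asymptotics.isLittleO_pow_pow_atTop_of_lt (𝕜 := ℝ) one_lt_two).comp_tendsto
        tendsto_natCast_atTop_atTop
      simpa [Function.comp_def] using this
    exact (this.comp_tendsto hsqrt).trans_isBigO hO
  have h1 := (h.comp_tendsto hsqrt).trans_isBigO hO
  have h2 : (fun n => ∑ s ∈ Finset.range (n - Nat.sqrt n ^ 2), E (Nat.sqrt n ^ 2 + s)) =o[atTop]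
      fun n : ℕ => (n : ℝ) := by
    refine Asymptotics.IsBigO.trans_isLittleO
      (Asymptotics.IsBigO.of_bound (2 * B) (Eventually.of_forall fun n => ?_)) ho
    have hB0 : 0 ≤ B := (abs_nonneg _).trans (hB 0)
    have hn : n - Nat.sqrt n ^ 2 ≤ 2 * Nat.sqrt n := by
      have := Nat.sqrt_le_add n
      rw [sq]
      omega
    have hn' : ((n - Nat.sqrt n ^ 2 : ℕ) : ℝ) ≤ 2 * Nat.sqrt n := by exact_mod_cast hn
    rw [Real.norm_eq_abs, Real.norm_of_nonneg (by positivity)]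
    refine (Finset.abs_sum_le_sum_abs _ _).trans ((Finset.sum_le_sum fun s _ => hB _).trans ?_)
    rw [Finset.sum_const, Finset.card_range, nsmul_eq_mul]
    nlinarith
  refine (h1.add h2).congr_left fun n => ?_
  rw [Function.comp_apply, ← Finset.sum_range_add, Nat.add_sub_cancel' (Nat.sqrt_le' n)]

theorem blockPoint_mem_Icc (K : ℕ → ℕ) (n : ℕ) : blockPoint K n ∈ Icc (0 : ℝ) 1 :=
  digitPoint_mem_Icc fun _ => blockSeq_lt _ _

theorem abs_orbitAvg_le {φ : ℝ → ℝ} {B : ℝ} (hB : ∀ x ∈ Icc (0 : ℝ) 1, |φ x| ≤ B) (k : ℕ) :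
    |orbitAvg φ k| ≤ B := by
  have hk : (0 : ℝ) < (k + 1 : ℕ) := by exact_mod_cast Nat.succ_pos k
  rw [orbitAvg, abs_div, abs_of_pos hk, div_le_iff₀ hk]
  refine (Finset.abs_sum_le_sum_abs _ _).trans
    ((Finset.sum_le_sum fun s _ => hB _ (perPoint_mem_Icc k s)).trans ?_)
  rw [Finset.sum_const, Finset.card_range, nsmul_eq_mul, mul_comm]

theorem abs_sum_block_sub_le {φ : ℝ → ℝ} {B ε : ℝ} {K : ℕ → ℕ} {m L : ℕ}
    (hB : ∀ x ∈ Icc (0 : ℝ) 1, |φ x| ≤ B) (hε : 0 ≤ ε)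
    (hφ : ∀ x ∈ Icc (0 : ℝ) 1, ∀ y ∈ Icc (0 : ℝ) 1, |x - y| < 1 / 7 ^ L → |φ x - φ y| ≤ ε) :
    |∑ s ∈ Finset.range (2 * m + 1), φ (blockPoint K (m ^ 2 + s)) -
        (2 * m + 1) * orbitAvg φ (K m)| ≤
      2 * m * ε + 2 * B * (L + 1) + 2 * B * (K m + 1) := by
  have hB0 : 0 ≤ B := (abs_nonneg _).trans (hB 0 (by simp))
  have hpt : ∀ s, |φ (blockPoint K (m * m + 1 + s)) - φ (perPoint (K m) (m * m + 1 + s))| ≤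
      ε + if 2 * m < s + L then 2 * B else 0 := by
    intro s
    split_ifs with h
    · have h1 := hB _ (blockPoint_mem_Icc K (m * m + 1 + s))
      have h2 := hB _ (perPoint_mem_Icc (K m) (m * m + 1 + s))
      have := abs_sub (φ (blockPoint K (m * m + 1 + s))) (φ (perPoint (K m) (m * m + 1 + s)))
      linarith
    · rw [add_zero]
      exact hφ _ (blockPoint_mem_Icc _ _) _ (perPoint_mem_Icc _ _)
        (abs_blockPoint_sub_perPoint_lt (not_lt.1 h))
  have hcount : ∑ s ∈ Finset.range (2 * m), (if 2 * m < s + L then 2 * B else 0) ≤ 2 * B * L := by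
    rw [← Finset.sum_filter, Finset.sum_const, nsmul_eq_mul, mul_comm]
    refine mul_le_mul_of_nonneg_left ?_ (by positivity)
    have : (Finset.range (2 * m)).filter (fun s => 2 * m < s + L) ⊆
        Finset.Ico (2 * m - L) (2 * m) := fun s hs => by
      simp only [Finset.mem_filter, Finset.mem_range] at hs
      rw [Finset.mem_Ico]
      omega
    have hc := Finset.card_le_card this
    rw [Nat.card_Ico] at hc
    exact_mod_cast hc.trans (by omega : 2 * m - (2 * m - L) ≤ L)
  have h1 : |∑ s ∈ Finset.range (2 * m), (φ (blockPoint K (m * m + 1 + s)) -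
      φ (perPoint (K m) (m * m + 1 + s)))| ≤ 2 * m * ε + 2 * B * L := by
    refine (Finset.abs_sum_le_sum_abs _ _).trans ((Finset.sum_le_sum fun s _ => hpt s).trans ?_)
    rw [Finset.sum_add_distrib, Finset.sum_const, Finset.card_range, nsmul_eq_mul]
    push_cast
    linarith
  have h2 := abs_sum_window_sub_le (g := fun n => φ (perPoint (K m) n)) (Nat.succ_pos (K m))
    (fun n => by rw [perPoint_add_period]) (fun n => hB _ (perPoint_mem_Icc _ n))
    (m * m + 1) (2 * m)
  have h3 := hB _ (blockPoint_mem_Icc K (m ^ 2))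
  have h4 := abs_orbitAvg_le hB (K m)
  rw [Finset.sum_sub_distrib] at h1
  change |_ - _ * orbitAvg φ (K m)| ≤ _ at h2
  push_cast at h2
  rw [Finset.sum_range_succ', add_zero]
  have hsum : ∑ s ∈ Finset.range (2 * m), φ (blockPoint K (m ^ 2 + (s + 1))) =
      ∑ s ∈ Finset.range (2 * m), φ (blockPoint K (m * m + 1 + s)) :=
    Finset.sum_congr rfl fun s _ => by rw [show m ^ 2 + (s + 1) = m * m + 1 + s by ring]
  rw [hsum]
  rw [abs_le] at h1 h2 h3 h4 ⊢
  constructor <;> linarith [h1.1, h1.2, h2.1, h2.2, h3.1, h3.2, h4.1, h4.2]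

theorem isLittleO_sum_block_sub {φ : ℝ → ℝ} (hφ : Continuous φ) :
    (fun m => ∑ s ∈ Finset.range (2 * m + 1), φ (blockPoint stageSelector (m ^ 2 + s)) -
        (2 * m + 1) * orbitAvg φ (stageSelector m)) =o[atTop]
      fun m : ℕ => (2 * m + 1 : ℝ) := by
  obtain ⟨B, hB⟩ := isCompact_Icc.exists_bound_of_continuousOn
    (hφ.continuousOn (s := Icc (0 : ℝ) 1))
  have hB0 : 0 ≤ B := (abs_nonneg _).trans (hB 0 (by simp))
  refine Asymptotics.IsLittleO.of_bound fun c hc => ?_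
  have huc := isCompact_Icc.uniformContinuousOn_of_continuous
    (hφ.continuousOn (s := Icc (0 : ℝ) 1))
  obtain ⟨δ, hδ, hφδ⟩ := Metric.uniformContinuousOn_iff.1 huc (c / 3) (by positivity)
  obtain ⟨L, hL⟩ := exists_seven_pow_lt hδ
  have ht : Tendsto (fun M : ℕ => c / 3 * (2 * M + 1 : ℝ)) atTop atTop :=
    (tendsto_atTop_add_const_right _ _
      (tendsto_natCast_atTop_atTop.const_mul_atTop two_pos)).const_mul_atTop (by positivity)
  filter_upwards [ht.eventually_ge_atTop (2 * B * (L + 1)),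
    (isLittleO_ruler_add_one.const_mul_left (2 * B)).bound (by positivity : 0 < c / 3)]
    with m h1 h2
  have h3 := abs_sum_block_sub_le (K := stageSelector) (m := m) hB (by positivity : 0 ≤ c / 3)
    (L := L) fun x hx y hy hxy => (hφδ x hx y hy (hxy.trans hL)).le
  have h4 : (stageSelector m : ℝ) ≤ ruler m := by exact_mod_cast stageSelector_le_ruler m
  have h5 : 2 * B * (stageSelector m + 1) ≤ 2 * B * (ruler m + 1 : ℝ) :=
    mul_le_mul_of_nonneg_left (by linarith) (by positivity)
  rw [Real.norm_of_nonneg (by positivity), Real.norm_of_nonneg (by positivity)] at h2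
  rw [Real.norm_eq_abs, Real.norm_of_nonneg (by positivity)]
  linarith

theorem tendsto_average_blockPoint {φ : ℝ → ℝ} (hφ : Continuous φ) :
    Tendsto (fun n : ℕ => (n : ℝ)⁻¹ * ∑ i ∈ Finset.range n, φ (blockPoint stageSelector i)) atTop
      (𝓝 (∫ x, φ x ∂physMeasure)) := by
  obtain ⟨B, hB⟩ := isCompact_Icc.exists_bound_of_continuousOn
    (hφ.continuousOn (s := Icc (0 : ℝ) 1))
  set l := ∫ x, φ x ∂physMeasure
  have hav := isLittleO_sum_stageSelector_sub (abs_orbitAvg_le hB)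
    (hasSum_integral_physMeasure hφ)
  have h1 := isLittleO_sum_two_mul_add_one_mul (B := B + |l|)
    (fun m => (abs_sub _ _).trans (add_le_add_left (abs_orbitAvg_le hB _) _)) hav
  have h2 := (isLittleO_sum_block_sub hφ).sum_two_mul_add_one
  have h3 : (fun n => ∑ i ∈ Finset.range n, (φ (blockPoint stageSelector i) - l)) =o[atTop]
      fun n : ℕ => (n : ℝ) := by
    refine isLittleO_sum_of_sq (B := B + |l|)
      (fun n => (abs_sub _ _).trans (add_le_add_left (hB _ (blockPoint_mem_Icc _ _)) _)) ?_
    refine (h1.add h2).congr_left fun M => ?_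
    rw [sum_range_sq, ← Finset.sum_add_distrib]
    refine Finset.sum_congr rfl fun m _ => ?_
    rw [Finset.sum_sub_distrib, Finset.sum_const, Finset.card_range, nsmul_eq_mul]
    push_cast
    ring
  have h4 := h3.tendsto_div_nhds_zero.add_const l
  rw [zero_add] at h4
  refine h4.congr' ?_
  filter_upwards [eventually_gt_atTop 0] with n hn
  have : (n : ℝ) ≠ 0 := by exact_mod_cast hn.ne'
  rw [Finset.sum_sub_distrib, Finset.sum_const, Finset.card_range, nsmul_eq_mul]
  field_simp
  ring

theorem tendsto_average_of_shift {u : ℕ → ℝ} {k : ℕ} {l : ℝ}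
    (h : Tendsto (fun n : ℕ => (n : ℝ)⁻¹ * ∑ i ∈ Finset.range n, u (i + k)) atTop (𝓝 l)) :
    Tendsto (fun n : ℕ => (n : ℝ)⁻¹ * ∑ i ∈ Finset.range n, u i) atTop (𝓝 l) := by
  rw [← tendsto_add_atTop_iff_nat k]
  have h1 : Tendsto (fun n : ℕ => (n : ℝ) / (n + k : ℝ)) atTop (𝓝 1) :=
    tendsto_natCast_div_add_atTop (k : ℝ)
  have h2 : Tendsto (fun n : ℕ => ((n + k : ℕ) : ℝ)⁻¹ * ∑ i ∈ Finset.range k, u i) atTop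
      (𝓝 (0 * ∑ i ∈ Finset.range k, u i)) :=
    ((tendsto_inv_atTop_zero.comp tendsto_natCast_atTop_atTop).comp
      (tendsto_add_atTop_nat k)).mul_const _
  have h3 := (h1.mul h).add h2
  rw [zero_mul, one_mul, add_zero] at h3
  refine h3.congr' ?_
  filter_upwards [eventually_gt_atTop 0] with n hn
  have hn' : (n : ℝ) ≠ 0 := by exact_mod_cast hn.ne'
  have hs : ∑ i ∈ Finset.range (n + k), u i =
      ∑ i ∈ Finset.range k, u i + ∑ i ∈ Finset.range n, u (i + k) := by
    rw [add_comm n k, Finset.sum_range_add]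
    simp only [add_comm k]
  rw [hs]
  push_cast
  field_simp
  ring

theorem integral_empMeasure {φ : ℝ → ℝ} (hφ : Continuous φ) (T : ℝ → ℝ) (x : ℝ) (n : ℕ) :
    ∫ y, φ y ∂(empMeasure T x n) = (n : ℝ)⁻¹ * ∑ i ∈ Finset.range n, φ (T^[i] x) := by
  rw [empMeasure, integral_smul_measure, integral_finsetSum_measure
    fun i _ => integrable_dirac' hφ.stronglyMeasurable (by simp)]
  simp only [integral_dirac' _ _ hφ.stronglyMeasurable]
  rw [ENNReal.toReal_inv, ENNReal.toReal_natCast, smul_eq_mul]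

theorem ae_weakTendsto_physMeasure :
    ∀ᵐ x ∂(volume.restrict (Icc (0 : ℝ) 1)), WeakTendsto (empMeasure attractorMap x)
      physMeasure := by
  filter_upwards [ae_exists_iterate_eq criticalValue_mem_Icc] with x hx φ
  obtain ⟨k, hk⟩ := hx
  simp only [integral_empMeasure φ.continuous]
  refine tendsto_average_of_shift (u := fun i => φ (attractorMap^[i] x)) (k := k) ?_
  have hit : ∀ i, attractorMap^[i + k] x = blockPoint stageSelector i := fun i => by
    rw [Function.iterate_add_apply, ← attractorMap_iterate_criticalValue]
    exact congrArg _ hk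
  simpa only [hit] using tendsto_average_blockPoint φ.continuous

theorem not_sigmaOne_compl_haltSet : ¬ SigmaOne HaltSetᶜ := by
  rintro ⟨f, hf, h⟩
  refine ComputablePred.halting_problem_not_re 0 ?_
  have hp : Partrec₂ fun (c : Nat.Partrec.Code) (n : ℕ) =>
      (Part.some (f (Encodable.encode c, n)) : Part Bool) :=
    (hf.comp ((Computable.encode.comp Computable.fst).pair Computable.snd)).partrec
  refine (Partrec.dom_re (Partrec.rfind hp)).of_eq fun c => ?_
  have hc : (Encodable.encode c ∈ HaltSetᶜ) ↔ ¬ (c.eval 0).Dom := by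
    simp [HaltSet]
  rw [← hc, h]
  refine Nat.rfind_dom.trans (exists_congr fun n => ?_)
  exact ⟨fun hn => (Part.mem_some_iff.1 hn.1).symm,
    fun hn => ⟨Part.mem_some_iff.2 hn.symm, fun _ => trivial⟩⟩

theorem exists_sum_gt_iff_of_eq_ciSup {a b : ℝ} {u v : ℕ → ℝ} (ha : 0 < a) (hb : 0 < b)
    (hu : a = ⨆ k, u k) (hv : b = ⨆ k, v k) (c : ℝ) :
    (∃ k l, c < u k + v l) ↔ c < a + b := by
  have hbdd : ∀ {w : ℕ → ℝ}, 0 < (⨆ k, w k) → BddAbove (range w) := fun {w} hw => by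
    by_contra hn
    rw [Real.iSup_of_not_bddAbove hn] at hw
    exact lt_irrefl _ hw
  constructor
  · rintro ⟨k, l, h⟩
    have h1 := le_ciSup (hbdd (hu ▸ ha)) k
    have h2 := le_ciSup (hbdd (hv ▸ hb)) l
    rw [← hu] at h1
    rw [← hv] at h2
    linarith
  · intro h
    have h1 : a - (a + b - c) / 2 < ⨆ k, u k := by rw [← hu]; linarith
    have h2 : b - (a + b - c) / 2 < ⨆ k, v k := by rw [← hv]; linarith
    obtain ⟨k, hk⟩ := exists_lt_of_lt_ciSup h1
    obtain ⟨l, hl⟩ := exists_lt_of_lt_ciSup h2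
    exact ⟨k, l, by linarith⟩

theorem computable_decide_one_lt_add : Computable fun p : ℚ × ℚ => decide (1 < p.1 + p.2) := by
  classical
  have hd : Computable fun p : (ℕ × ℕ × ℕ) × (ℕ × ℕ × ℕ) =>
      decide (FracLt (p.1.2.2 + p.1.2.1, p.1.1, p.1.2.2) p.2) := by
    have h2 : Primrec fun p : (ℕ × ℕ × ℕ) × (ℕ × ℕ × ℕ) => p.1.2 :=
      Primrec.snd.comp Primrec.fst
    exact (primrec_fracLt.comp ((Primrec.nat_add.comp (Primrec.snd.comp h2)
      (Primrec.fst.comp h2)).pair ((Primrec.fst.comp Primrec.fst).pair (Primrec.snd.comp h2)))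
      Primrec.snd).decide.to_comp
  refine (hd.comp ((computable_ratSplit.comp Computable.fst).pair
    (computable_ratSplit.comp Computable.snd))).of_eq fun p => decide_eq_decide.2 ?_
  refine (fracLt_iff (s := ((ratSplit p.1).2.2 + (ratSplit p.1).2.1, (ratSplit p.1).1,
    (ratSplit p.1).2.2)) (ratSplit_pos p.1) (ratSplit_pos p.2)).trans ?_
  have hpos : (0 : ℝ) < (ratSplit p.1).2.2 := by exact_mod_cast ratSplit_pos p.1
  have h : fracVal ((ratSplit p.1).2.2 + (ratSplit p.1).2.1, (ratSplit p.1).1,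
      (ratSplit p.1).2.2) = 1 - fracVal (ratSplit p.1) := by
    simp only [fracVal]
    field_simp
    push_cast
    ring
  rw [h, fracVal_ratSplit, fracVal_ratSplit, ← Rat.cast_lt (K := ℝ)]
  push_cast
  constructor <;> intro h <;> linarith

theorem attractorOf_subset_union (S : Set ℕ) :
    attractorOf S ⊆ Ioo (-1 : ℝ) (1 / 2) ∪ Ioo (1 / 2 : ℝ) 2 := by
  intro y hy
  obtain ⟨h0, h1⟩ := attractorOf_subset S hy
  obtain ⟨j, hj, -, hl, hr⟩ := mem_biUnion_of_mem_attractorOf 1 hy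
  have hd : prefixVal (ternaryDigit j) 1 = 0 ∨ prefixVal (ternaryDigit j) 1 = 2 ∨
      prefixVal (ternaryDigit j) 1 = 4 := by
    have := ternaryDigit_lt j 0
    simp only [prefixVal]
    omega
  rcases hd with hd | hd | hd <;> rw [hd] at hl hr
  · exact Or.inl ⟨by linarith, by norm_num at hr; linarith⟩
  · exact Or.inl ⟨by linarith, by norm_num at hr; linarith⟩
  · exact Or.inr ⟨by norm_num at hl; linarith, by linarith⟩

theorem avoids_ternaryDigit_two (S : Set ℕ) : Avoids S (ternaryDigit 2) := by
  intro i e _ hm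
  have h := hm.2.2
  have : 2 / 3 ^ (i + 1 + e) = 0 := Nat.div_eq_of_lt
    (lt_of_lt_of_le (by norm_num : 2 < 3 ^ 1) (Nat.pow_le_pow_right (by norm_num) (by omega)))
  simp [ternaryDigit, this] at h

theorem physMeasure_left_pos : 0 < physMeasure (Ioo (-1 : ℝ) (1 / 2)) := by
  refine physMeasure_pos_of_isOpen isOpen_Ioo
    ⟨perPoint 0 0, ⟨?_, ?_⟩, perPoint_mem_attractorOf (avoids_ternaryDigit_zero _) 0⟩
  · linarith [(perPoint_mem_Icc 0 0).1]
  · refine (abs_digitPoint_sub_prefixVal_le (fun n => perSeq_lt 0 (n + 0)) 1).2.trans ?_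
    norm_num [prefixVal, perSeq, ternaryDigit]

theorem physMeasure_right_pos : 0 < physMeasure (Ioo (1 / 2 : ℝ) 2) := by
  refine physMeasure_pos_of_isOpen isOpen_Ioo
    ⟨perPoint 2 0, ⟨?_, ?_⟩, perPoint_mem_attractorOf (avoids_ternaryDigit_two _) 0⟩
  · refine lt_of_lt_of_le ?_ (abs_digitPoint_sub_prefixVal_le (fun n => perSeq_lt 2 (n + 0)) 1).1
    norm_num [prefixVal, perSeq, ternaryDigit]
  · linarith [(perPoint_mem_Icc 2 0).2]

theorem physMeasure_left_add_right :
    physMeasure.real (Ioo (-1 : ℝ) (1 / 2)) + physMeasure.real (Ioo (1 / 2 : ℝ) 2) = 1 := by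
  have hd : Disjoint (Ioo (-1 : ℝ) (1 / 2)) (Ioo (1 / 2 : ℝ) 2) :=
    Set.disjoint_left.2 fun x hx hx' => lt_asymm hx.2 hx'.1
  rw [← measureReal_union hd measurableSet_Ioo]
  refine le_antisymm measureReal_le_one ?_
  have : physMeasure.real (attractorOf HaltSet) = 1 := by
    rw [measureReal_def, physMeasure_attractor, ENNReal.toReal_one]
  exact this.ge.trans (measureReal_mono (attractorOf_subset_union _))

theorem one_lt_physMeasure_add_iff (e : ℕ) :
    1 < physMeasure.real (Ioo (-1 : ℝ) (1 / 2) ∪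
        Ioo ((markerInterval e).1 : ℝ) ((markerInterval e).2 : ℝ)) +
      physMeasure.real (Ioo (1 / 2 : ℝ) 2) ↔ e ∉ HaltSet := by
  have hadd := physMeasure_left_add_right
  have hd : Disjoint (Ioo (-1 : ℝ) (1 / 2))
      (Ioo ((markerInterval e).1 : ℝ) ((markerInterval e).2 : ℝ)) :=
    Set.disjoint_left.2 fun x hx hx' => lt_asymm hx.2 ((half_lt_markerInterval e).trans hx'.1)
  rw [measureReal_union hd measurableSet_Ioo, ← Ioo_markerInterval_inter_nonempty_iff e HaltSet]
  constructor
  · intro h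
    by_contra hn
    have h0 : physMeasure (Ioo ((markerInterval e).1 : ℝ) ((markerInterval e).2 : ℝ)) = 0 :=
      measure_mono_null (fun x hx hxA => hn ⟨x, hx, hxA⟩) (ae_iff.1 ae_mem_attractor)
    rw [measureReal_def physMeasure (Ioo ((markerInterval e).1 : ℝ) _), h0,
      ENNReal.toReal_zero] at h
    linarith
  · intro h
    have hpos := ENNReal.toReal_pos (physMeasure_pos_of_isOpen isOpen_Ioo h).ne'
      (measure_ne_top _ _)
    rw [← measureReal_def] at hpos
    linarith

theorem sigmaOne_exists_one_lt_add {u v : ℕ × ℕ → ℚ} (hu : Computable u) (hv : Computable v) :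
    SigmaOne {e | ∃ k l, 1 < u (e, k) + v (e, l)} := by
  have hp : Computable fun p : ℕ × ℕ => p.2.unpair := Computable.unpair.comp Computable.snd
  have hk : Computable fun p : ℕ × ℕ => u (p.1, p.2.unpair.1) :=
    hu.comp (Computable.fst.pair (Computable.fst.comp hp))
  have hl : Computable fun p : ℕ × ℕ => v (p.1, p.2.unpair.2) :=
    hv.comp (Computable.fst.pair (Computable.snd.comp hp))
  refine ⟨_, computable_decide_one_lt_add.comp (hk.pair hl), fun e => ?_⟩
  simp only [decide_eq_true_eq, mem_ofPred_eq]
  constructor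
  · rintro ⟨k, l, h⟩
    exact ⟨Nat.pair k l, by simpa using h⟩
  · rintro ⟨a, h⟩
    exact ⟨_, _, h⟩

theorem not_computableIntervalMeasure_physMeasure : ¬ ComputableIntervalMeasure physMeasure := by
  rintro ⟨q, hq, h⟩
  have hW : Computable fun p : ℕ × ℕ => ([(-1, 1 / 2), markerInterval p.1], p.2) :=
    (Computable.list_cons.comp (Computable.const _) (Computable.list_cons.comp
      (primrec_markerInterval.to_comp.comp Computable.fst) (Computable.const []))).pair
      Computable.snd
  have hC : Computable fun p : ℕ × ℕ => ([((1 / 2 : ℚ), (2 : ℚ))], p.2) :=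
    (Computable.const _).pair Computable.snd
  have hs := sigmaOne_exists_one_lt_add (hq.comp hW) (hq.comp hC)
  refine not_sigmaOne_compl_haltSet ?_
  convert hs using 1
  ext e
  have h1 := h [(-1, 1 / 2), markerInterval e]
  have h2 := h [(1 / 2, 2)]
  simp only [List.mem_cons, List.not_mem_nil, or_false, iUnion_iUnion_eq_or_left,
    iUnion_iUnion_eq_left] at h1 h2
  push_cast at h1 h2
  rw [← measureReal_def] at h1 h2
  have hCpos : 0 < physMeasure.real (Ioo (1 / 2 : ℝ) 2) :=
    ENNReal.toReal_pos physMeasure_right_pos.ne' (measure_ne_top _ _)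
  have hVpos : 0 < physMeasure.real (Ioo (-1 : ℝ) (1 / 2) ∪
      Ioo ((markerInterval e).1 : ℝ) ((markerInterval e).2 : ℝ)) :=
    (ENNReal.toReal_pos physMeasure_left_pos.ne' (measure_ne_top _ _)).trans_le
      (measureReal_mono subset_union_left)
  rw [mem_compl_iff, ← one_lt_physMeasure_add_iff,
    ← exists_sum_gt_iff_of_eq_ciSup hVpos hCpos h1 h2]
  exact_mod_cast Iff.rfl

/-- A computable interval map with a Π₁-complete transitive set which is both the metric and
the statistical attractor w.r.t. Lebesgue measure, and whose physical measure is not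
computable. -/
theorem stmt18 :
    ∃ (f : ℝ → ℝ) (A : Set ℝ),
      ComputableRealMap f ∧ Set.MapsTo f (Set.Icc 0 1) (Set.Icc 0 1) ∧
      IsClosed A ∧ A ⊆ Set.Icc 0 1 ∧ Set.MapsTo f A A ∧
      -- (1) A is Π₁ and its inner collection is Π₁-complete
      SigmaOne {p : ℚ × ℚ | p.1 < p.2 ∧ Set.Icc (p.1 : ℝ) (p.2 : ℝ) ∩ A = ∅} ∧
      ((fun e : ℕ => e ∉ HaltSet) ≤₀
        fun p : ℚ × ℚ => p.1 < p.2 ∧ (Set.Ioo (p.1 : ℝ) (p.2 : ℝ) ∩ A).Nonempty) ∧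
      -- (2) f is transitive on A
      (∃ x ∈ A, A ⊆ closure (Set.range fun n : ℕ => f^[n] x)) ∧
      -- (3) A is a metric attractor w.r.t. Lebesgue measure on [0,1]
      IsMetricAttractor f (volume.restrict (Set.Icc (0:ℝ) 1)) A ∧
      -- (3)+(4) A is a statistical attractor whose physical measure is not computable
      (∃ μ : Measure ℝ, IsProbabilityMeasure μ ∧ Measure.map f μ = μ ∧
        measSupport μ = A ∧
        (∀ᵐ x ∂(volume.restrict (Set.Icc (0:ℝ) 1)), WeakTendsto (empMeasure f x) μ) ∧
        ¬ ComputableIntervalMeasure μ) := by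
  have hc := criticalValue_mem_Icc
  exact ⟨attractorMap, attractorOf HaltSet, computableRealMap_attractorMap,
    fun x hx => threeTent_mem_Icc hc hx.1, isClosed_attractorOf _, attractorOf_subset _,
    mapsTo_attractorOf _ _, sigmaOne_outer, manyOneReducible_inner, exists_dense_orbit,
    isMetricAttractor_attractorMap, physMeasure, inferInstance, map_physMeasure,
    measSupport_physMeasure, ae_weakTendsto_physMeasure, not_computableIntervalMeasure_physMeasure⟩
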